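/- arXiv:2008.07692 — 2 statements merged into one kernel-verified Lean document; each statement's English description precedes it below -/
import Mathlib

section
/- There exist real parameters s_1, s_2, q_{1,1}, q_{1,2}, q_{2,1}, q_{2,2}, p_{1,1}, p_{1,2}, p_{2,1}, p_{2,2} with (p_{1,1}+p_{2,2})(q_{1,1}+q_{2,2}) ≠ 0 such that the planar system ẋ = s_1 + q_{1,1}√(x) + q_{1,2}√(y) + p_{1,1}x + p_{1,2}y, ẏ = s_2 + q_{2,1}√(x) + q_{2,2}√(y) + p_{2,1}x + p_{2,2}y has at least one limit cycle, and this limit cycle crosses the set Σ = {(x,y) : xy = 0}. -/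
open Real Set

noncomputable section

/-- `φ` is a solution of the planar ODE `(ẋ,ẏ) = X(x,y)`. -/
def IsSolution (X : ℝ × ℝ → ℝ × ℝ) (φ : ℝ → ℝ × ℝ) : Prop :=
  ∀ t : ℝ, HasDerivAt φ (X (φ t)) t

/-- `φ` is a (non-constant) periodic orbit of the system `(ẋ,ẏ) = X(x,y)`. -/
def IsPeriodicOrbit (X : ℝ × ℝ → ℝ × ℝ) (φ : ℝ → ℝ × ℝ) : Prop :=
  IsSolution X φ ∧ (∃ T > 0, Function.Periodic φ T) ∧ ¬ (∃ c, ∀ t, φ t = c)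

/-- A limit cycle is a periodic orbit that is isolated in the set of all periodic
orbits: it has an open neighbourhood containing no other periodic orbit. -/
def IsLimitCycle (X : ℝ × ℝ → ℝ × ℝ) (φ : ℝ → ℝ × ℝ) : Prop :=
  IsPeriodicOrbit X φ ∧
  ∃ U : Set (ℝ × ℝ), IsOpen U ∧ Set.range φ ⊆ U ∧
    ∀ ψ : ℝ → ℝ × ℝ, IsPeriodicOrbit X ψ → Set.range ψ ⊆ U →
      Set.range ψ = Set.range φ

/-- The system `(ẋ,ẏ) = X(x,y)` has at least `N` (pairwise distinct) limit cycles. -/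
def HasAtLeastNLimitCycles (X : ℝ × ℝ → ℝ × ℝ) (N : ℕ) : Prop :=
  ∃ φ : Fin N → ℝ → ℝ × ℝ, (∀ i, IsLimitCycle X (φ i)) ∧
    ∀ i j, i ≠ j → Set.range (φ i) ≠ Set.range (φ j)

/-- The odd extension of the square root: `√(z) = sgn(z)·√|z|`. -/
def oddSqrt (z : ℝ) : ℝ := Real.sign z * Real.sqrt |z|


lemma oddSqrt_eq (z : ℝ) : oddSqrt z = Real.sqrt z - Real.sqrt (-z) := by
  unfold oddSqrt
  rcases lt_trichotomy z 0 with h | h | h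
  · rw [Real.sign_of_neg h, abs_of_neg h, Real.sqrt_eq_zero_of_nonpos h.le]; ring
  · subst h; simp
  · rw [Real.sign_of_pos h, abs_of_pos h, Real.sqrt_eq_zero_of_nonpos (x := -z) (by linarith)]; ring

lemma oddSqrt_cont : Continuous oddSqrt := by
  have : oddSqrt = fun z => Real.sqrt z - Real.sqrt (-z) := funext oddSqrt_eq
  rw [this]; fun_prop

lemma oddSqrt_mul (ρ c : ℝ) (h : 0 < ρ) : oddSqrt (ρ ^ 2 * c) = ρ * oddSqrt c := by
  rw [oddSqrt_eq, oddSqrt_eq, ← mul_neg, Real.sqrt_mul (by positivity), Real.sqrt_mul (by positivity),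
    Real.sqrt_sq h.le]; ring

lemma oddSqrt_mul_abs (c : ℝ) : oddSqrt c * |oddSqrt c| = c := by
  unfold oddSqrt
  rcases lt_trichotomy c 0 with h | h | h
  · rw [Real.sign_of_neg h, abs_of_neg h]
    have := Real.mul_self_sqrt (show 0 ≤ -c by linarith)
    rw [abs_mul, abs_of_nonneg (Real.sqrt_nonneg _)]; norm_num; linarith
  · subst h; simp
  · rw [Real.sign_of_pos h, abs_of_pos h]
    have := Real.mul_self_sqrt h.le
    rw [abs_mul, abs_of_nonneg (Real.sqrt_nonneg _)]; norm_num; linarith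

lemma key_pos (C D : ℝ) (h : C ≠ 0 ∨ D ≠ 0) :
    0 < |C| ^ 3 + |D| ^ 3 + C * D * (|C| - |D|) := by
  have ha := abs_nonneg C
  have hb := abs_nonneg D
  have hab : 0 < |C| + |D| := by
    rcases h with h | h
    · have := abs_pos.2 h; linarith
    · have := abs_pos.2 h; linarith
  have h1 : |C * D * (|C| - |D|)| ≤ |C| * |D| * (|C| + |D|) - min (|C|) (|D|) * |C| * |D| := by
    rw [abs_mul, abs_mul]
    rcases le_total |C| |D| with h | h
    · rw [abs_of_nonpos (by linarith : |C| - |D| ≤ 0), min_eq_left h]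
      nlinarith [mul_nonneg (mul_nonneg ha hb) ha]
    · rw [abs_of_nonneg (by linarith : 0 ≤ |C| - |D|), min_eq_right h]
      nlinarith [mul_nonneg (mul_nonneg ha hb) hb]
  have h2 := neg_abs_le (C * D * (|C| - |D|))
  generalize |C| = a at *
  generalize |D| = b at *
  have h4 : a ^ 3 + b ^ 3 - a * b * (a + b) = (a + b) * (a - b) ^ 2 := by ring
  have h5 : 0 ≤ (a + b) * (a - b) ^ 2 := by positivity
  rcases eq_or_lt_of_le ha with h | h
  · subst h
    have : 0 < b := by linarith
    have : 0 < b ^ 3 := by positivity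
    have h6 : min 0 b = 0 := min_eq_left hb
    rw [h6] at h1
    nlinarith
  · rcases eq_or_lt_of_le hb with h' | h'
    · subst h'
      have : 0 < a ^ 3 := by positivity
      have h6 : min a 0 = 0 := min_eq_right ha
      rw [h6] at h1
      nlinarith
    · have : 0 < min a b * a * b := by positivity
      linarith

/-- radial component -/
def al (θ : ℝ) : ℝ := cos θ * (oddSqrt (cos θ) - oddSqrt (sin θ)) +
  sin θ * (oddSqrt (cos θ) + oddSqrt (sin θ))
/-- angular component -/
def be (θ : ℝ) : ℝ := cos θ * (oddSqrt (cos θ) + oddSqrt (sin θ)) -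
  sin θ * (oddSqrt (cos θ) - oddSqrt (sin θ))

lemma cs_ne (θ : ℝ) : oddSqrt (cos θ) ≠ 0 ∨ oddSqrt (sin θ) ≠ 0 := by
  by_contra! h
  have h1 := oddSqrt_mul_abs (cos θ)
  have h2 := oddSqrt_mul_abs (sin θ)
  rw [h.1] at h1
  rw [h.2] at h2
  have := sin_sq_add_cos_sq θ
  rw [← h1, ← h2] at this
  norm_num at this

lemma be_pos (θ : ℝ) : 0 < be θ := by
  have h := key_pos _ _ (cs_ne θ)
  unfold be
  have h1 := oddSqrt_mul_abs (cos θ)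
  have h2 := oddSqrt_mul_abs (sin θ)
  generalize oddSqrt (cos θ) = C at *
  generalize oddSqrt (sin θ) = D at *
  rw [← h1, ← h2]
  have h3 := sq_abs C
  have h4 := sq_abs D
  have : |C| ^ 3 + |D| ^ 3 + C * D * (|C| - |D|) =
    C * |C| * (C + D) - D * |D| * (C - D) := by
    rw [pow_succ, pow_succ |D|, h3, h4]; ring
  linarith

lemma al_pos (θ : ℝ) : 0 < al θ := by
  have h := key_pos _ (- oddSqrt (sin θ)) ((cs_ne θ).imp id neg_ne_zero.2)
  unfold al
  have h1 := oddSqrt_mul_abs (cos θ)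
  have h2 := oddSqrt_mul_abs (sin θ)
  generalize oddSqrt (cos θ) = C at *
  generalize oddSqrt (sin θ) = D at *
  rw [← h1, ← h2]
  rw [abs_neg] at h
  have h3 := sq_abs C
  have h4 := sq_abs D
  have : |C| ^ 3 + |D| ^ 3 + C * (-D) * (|C| - |D|) =
    C * |C| * (C - D) + D * |D| * (C + D) := by
    rw [pow_succ, pow_succ |D|, h3, h4]; ring
  linarith

lemma al_cont : Continuous al := by
  unfold al; have := oddSqrt_cont; fun_prop
lemma be_cont : Continuous be := by
  unfold be; have := oddSqrt_cont; fun_prop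
lemma al_per (θ : ℝ) : al (θ + 2 * π) = al θ := by simp [al]
lemma be_per (θ : ℝ) : be (θ + 2 * π) = be θ := by simp [be]

/-- a translate-equivariance principle for functions with periodic derivative -/
lemma eq_of_deriv (f g f' : ℝ → ℝ) (hf : ∀ x, HasDerivAt f (f' x) x)
    (hg : ∀ x, HasDerivAt g (f' x) x) (h0 : f 0 = g 0) (x : ℝ) : f x = g x := by
  have h : ∀ x, HasDerivAt (fun x => f x - g x) 0 x := fun x => by
    simpa using (hf x).fun_sub (hg x)
  have := is_const_of_deriv_eq_zero (fun x => (h x).differentiableAt) (fun x => (h x).deriv) x 0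
  linarith

lemma shift_deriv {f : ℝ → ℝ} {f' : ℝ} {x c : ℝ} (h : HasDerivAt f f' (x + c)) :
    HasDerivAt (fun x => f (x + c)) f' x := by
  simpa using HasDerivAt.comp_add_const x c h

lemma int_deriv {f : ℝ → ℝ} (hf : Continuous f) (x : ℝ) :
    HasDerivAt (fun x => ∫ s in (0:ℝ)..x, f s) (f x) x :=
  intervalIntegral.integral_hasDerivAt_right (hf.intervalIntegrable _ _)
    (hf.stronglyMeasurableAtFilter _ _) hf.continuousAt

/-- the periodic solution of the linear equation -/
lemma exists_eta : ∃ η : ℝ → ℝ, (∀ x, HasDerivAt η ((1 - al x * η x) / (2 * be x)) x) ∧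
    (∀ x, 0 < η x) ∧ (∀ x, η (x + 2 * π) = η x) := by
  have hbne : ∀ x, 2 * be x ≠ 0 := fun x => by have := be_pos x; positivity
  have hac : Continuous (fun x => al x / (2 * be x)) :=
    al_cont.div (continuous_const.mul be_cont) hbne
  have hapos : ∀ x, 0 < al x / (2 * be x) := fun x => by
    have := be_pos x; have := al_pos x; positivity
  set A : ℝ → ℝ := fun x => ∫ s in (0:ℝ)..x, al s / (2 * be s) with hA
  have hAd : ∀ x, HasDerivAt A (al x / (2 * be x)) x := fun x => int_deriv hac x
  have hA0 : A 0 = 0 := by simp [hA]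
  have hAc : Continuous A := continuous_iff_continuousAt.2 fun x => (hAd x).continuousAt
  have hApos : 0 < A (2 * π) :=
    intervalIntegral.intervalIntegral_pos_of_pos (hac.intervalIntegrable _ _) hapos (by positivity)
  have hAper : ∀ x, A (x + 2 * π) = A (2 * π) + A x := by
    apply eq_of_deriv _ _ (fun x => al x / (2 * be x))
    · intro x
      have := shift_deriv (hAd (x + 2 * π))
      rwa [al_per, be_per] at this
    · intro x; exact (hAd x).const_add _
    · simp [hA0]
  have hEc : Continuous (fun x => exp (A x) * (1 / (2 * be x))) :=
    (Real.continuous_exp.comp hAc).mul (continuous_const.div (continuous_const.mul be_cont) hbne)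
  have hEpos : ∀ x, 0 < exp (A x) * (1 / (2 * be x)) := fun x => by
    have := be_pos x; positivity
  set K : ℝ → ℝ := fun x => ∫ s in (0:ℝ)..x, exp (A s) * (1 / (2 * be s)) with hK
  have hKd : ∀ x, HasDerivAt K (exp (A x) * (1 / (2 * be x))) x := fun x => int_deriv hEc x
  have hK0 : K 0 = 0 := by simp [hK]
  have hKpos : 0 < K (2 * π) :=
    intervalIntegral.intervalIntegral_pos_of_pos (hEc.intervalIntegrable _ _) hEpos (by positivity)
  have hKper : ∀ x, K (x + 2 * π) = K (2 * π) + exp (A (2 * π)) * K x := by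
    apply eq_of_deriv _ _ (fun x => exp (A (2 * π)) * (exp (A x) * (1 / (2 * be x))))
    · intro x
      have := shift_deriv (hKd (x + 2 * π))
      rwa [be_per, hAper, exp_add, mul_assoc] at this
    · intro x; exact ((hKd x).const_mul _).const_add _
    · simp [hK0]
  have hKnn : ∀ x, 0 ≤ x → 0 ≤ K x := fun x hx =>
    intervalIntegral.integral_nonneg hx fun u _ => (hEpos u).le
  have hE1 : 1 < exp (A (2 * π)) := by rwa [Real.one_lt_exp_iff]
  set κ := K (2 * π) / (exp (A (2 * π)) - 1) with hκ
  have hκpos : 0 < κ := div_pos hKpos (by linarith)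
  have hκe : κ * (exp (A (2 * π)) - 1) = K (2 * π) := div_mul_cancel₀ _ (by linarith)
  set η : ℝ → ℝ := fun x => (κ + K x) * exp (-A x) with hη
  have hper : ∀ x, η (x + 2 * π) = η x := by
    intro x
    simp only [hη]
    rw [hKper, hAper, neg_add, exp_add, ← mul_assoc]
    congr 1
    rw [exp_neg]
    have : exp (A (2 * π)) ≠ 0 := by positivity
    field_simp
    linarith
  refine ⟨η, ?_, ?_, hper⟩
  · intro x
    have h1 := ((hKd x).const_add κ).fun_mul ((hAd x).fun_neg.exp)
    refine h1.congr_deriv (Eq.symm ?_)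
    have h2 : exp (A x) * exp (-A x) = 1 := by rw [← exp_add]; simp
    have := (be_pos x).ne'
    simp only [hη]
    field_simp
    linear_combination -h2
  · intro x
    have hp : Function.Periodic η (2 * π) := hper
    obtain ⟨y, hy, hxy⟩ := hp.exists_mem_Ico₀ (by positivity) x
    rw [hxy]
    have := hKnn y hy.1
    simp only [hη]
    positivity

/-- the scalar flow on the cycle -/
lemma exists_flow (h : ℝ → ℝ) (hc : Continuous h) (hp : ∀ x, 0 < h x)
    (hper : ∀ x, h (x + 2 * π) = h x) :
    ∃ (τ Θ : ℝ → ℝ) (T : ℝ), 0 < T ∧ (∀ x, HasDerivAt τ (h x) x) ∧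
      (∀ t, HasDerivAt Θ (1 / h (Θ t)) t) ∧ (∀ t, τ (Θ t) = t) ∧ (∀ x, Θ (τ x) = x) ∧
      (∀ t, Θ (t + T) = Θ t + 2 * π) := by
  set τ : ℝ → ℝ := fun x => ∫ s in (0:ℝ)..x, h s with hτ
  have hd : ∀ x, HasDerivAt τ (h x) x := fun x => int_deriv hc x
  have hτ0 : τ 0 = 0 := by simp [hτ]
  have hτc : Continuous τ := continuous_iff_continuousAt.2 fun x => (hd x).continuousAt
  have hmono : StrictMono τ := strictMono_of_hasDerivAt_pos hd hp
  have hT : 0 < τ (2 * π) := by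
    rw [← hτ0]; exact hmono (by positivity)
  have hP : Function.Periodic h (2 * π) := hper
  have htop := hP.tendsto_atTop_intervalIntegral_of_pos' (hc.intervalIntegrable _ _) hp
    (by positivity)
  have hbot := hP.tendsto_atBot_intervalIntegral_of_pos' (hc.intervalIntegrable _ _) hp
    (by positivity)
  have hsurj : Function.Surjective τ := hτc.surjective htop hbot
  have hadd : ∀ x, τ (x + 2 * π) = τ x + τ (2 * π) := by
    apply eq_of_deriv _ _ h
    · intro x
      have := shift_deriv (hd (x + 2 * π))
      rwa [hper] at this
    · intro x; exact (hd x).add_const _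
    · simp [hτ0]
  let e := hmono.orderIsoOfSurjective τ hsurj
  have he1 : ∀ t, τ (e.symm t) = t := fun t => e.apply_symm_apply t
  have he2 : ∀ x, e.symm (τ x) = x := fun x => e.symm_apply_apply x
  refine ⟨τ, e.symm, τ (2 * π), hT, hd, ?_, he1, he2, ?_⟩
  · intro t
    have := HasDerivAt.of_local_left_inverse (f := τ) (g := e.symm) (a := t)
      e.symm.continuous.continuousAt (hd _) (hp _).ne' (Filter.Eventually.of_forall he1)
    simpa using this
  · intro t
    apply hmono.injective
    rw [hadd, he1, he1]

lemma const_of_deriv {f : ℝ → ℝ} (h : ∀ x, HasDerivAt f 0 x) (x y : ℝ) : f x = f y :=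
  is_const_of_deriv_eq_zero (fun x => (h x).differentiableAt) (fun x => (h x).deriv) x y

/-- polar lift of a nonvanishing planar curve -/
lemma polar_lift (x y w ω : ℝ → ℝ) (hw : Continuous w) (hω : Continuous ω)
    (hx : ∀ t, HasDerivAt x (w t * x t - ω t * y t) t)
    (hy : ∀ t, HasDerivAt y (w t * y t + ω t * x t) t)
    (h0 : x 0 ≠ 0 ∨ y 0 ≠ 0) :
    ∃ l Θ : ℝ → ℝ, (∀ t, HasDerivAt l (w t) t) ∧ (∀ t, HasDerivAt Θ (ω t) t) ∧
      ∀ t, x t = exp (l t) * cos (Θ t) ∧ y t = exp (l t) * sin (Θ t) := by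
  obtain ⟨l0, θ0, hl1, hl2⟩ : ∃ l0 θ0, x 0 = exp l0 * cos θ0 ∧ y 0 = exp l0 * sin θ0 := by
    set z : ℂ := ⟨x 0, y 0⟩ with hz
    have hz0 : z ≠ 0 := by
      intro h
      have h1 := congrArg Complex.re h
      have h2 := congrArg Complex.im h
      simp [hz] at h1 h2
      tauto
    refine ⟨Real.log ‖z‖, Complex.arg z, ?_, ?_⟩
    · rw [Real.exp_log (norm_pos_iff.2 hz0), Complex.norm_mul_cos_arg]
    · rw [Real.exp_log (norm_pos_iff.2 hz0), Complex.norm_mul_sin_arg]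
  set l : ℝ → ℝ := fun t => l0 + ∫ s in (0:ℝ)..t, w s with hl
  set Θ : ℝ → ℝ := fun t => θ0 + ∫ s in (0:ℝ)..t, ω s with hΘ
  have hld : ∀ t, HasDerivAt l (w t) t := fun t => (int_deriv hw t).const_add _
  have hΘd : ∀ t, HasDerivAt Θ (ω t) t := fun t => (int_deriv hω t).const_add _
  have hl0 : l 0 = l0 := by simp [hl]
  have hΘ0 : Θ 0 = θ0 := by simp [hΘ]
  refine ⟨l, Θ, hld, hΘd, ?_⟩
  have ha : ∀ t, HasDerivAt (fun t => exp (-l t) * (x t * cos (Θ t) + y t * sin (Θ t))) 0 t := by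
    intro t
    have := (hld t).fun_neg.exp.fun_mul
      (((hx t).fun_mul (hΘd t).cos).fun_add ((hy t).fun_mul (hΘd t).sin))
    refine this.congr_deriv ?_
    ring
  have hb : ∀ t, HasDerivAt (fun t => exp (-l t) * (y t * cos (Θ t) - x t * sin (Θ t))) 0 t := by
    intro t
    have := (hld t).fun_neg.exp.fun_mul
      (((hy t).fun_mul (hΘd t).cos).fun_sub ((hx t).fun_mul (hΘd t).sin))
    refine this.congr_deriv ?_
    ring
  intro t
  have h1 := const_of_deriv ha t 0
  have h2 := const_of_deriv hb t 0
  simp only [hl0, hΘ0, hl1, hl2] at h1 h2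
  have e0 : exp (-l0) * exp l0 = 1 := by rw [← exp_add]; simp
  have et : exp (l t) * exp (-l t) = 1 := by rw [← exp_add]; simp
  have p0 := sin_sq_add_cos_sq θ0
  have pt := sin_sq_add_cos_sq (Θ t)
  have h1' : exp (-l t) * (x t * cos (Θ t) + y t * sin (Θ t)) = 1 := by
    rw [h1]; linear_combination e0 + exp (-l0) * exp l0 * p0
  have h2' : exp (-l t) * (y t * cos (Θ t) - x t * sin (Θ t)) = 0 := by
    rw [h2]; ring
  have h3 : x t * cos (Θ t) + y t * sin (Θ t) = exp (l t) := by
    linear_combination exp (l t) * h1' - (x t * cos (Θ t) + y t * sin (Θ t)) * et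
  have h4 : y t * cos (Θ t) - x t * sin (Θ t) = 0 := by
    linear_combination exp (l t) * h2' - (y t * cos (Θ t) - x t * sin (Θ t)) * et
  constructor
  · linear_combination cos (Θ t) * h3 - sin (Θ t) * h4 - x t * pt
  · linear_combination sin (Θ t) * h3 + cos (Θ t) * h4 - y t * pt

lemma main_cycle (X : ℝ × ℝ → ℝ × ℝ)
    (hX : ∀ z, X z = (-z.1 + (oddSqrt z.1 - oddSqrt z.2), -z.2 + (oddSqrt z.1 + oddSqrt z.2))) :
    ∃ φ : ℝ → ℝ × ℝ, IsLimitCycle X φ ∧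
      (Set.range φ ∩ {z : ℝ × ℝ | z.1 * z.2 = 0}).Nonempty := by
  obtain ⟨η, hηd, hηpos, hηper⟩ := exists_eta
  have hηc : Continuous η := continuous_iff_continuousAt.2 fun x => (hηd x).continuousAt
  have hh : ∀ x, 0 < be x * η x := fun x => mul_pos (be_pos x) (hηpos x)
  obtain ⟨τ, Θ, T, hT, hτd, hΘd, hτΘ, hΘτ, hΘT⟩ := exists_flow (fun x => 1 / (be x * η x))
    (continuous_const.div (be_cont.mul hηc) fun x => (hh x).ne')
    (fun x => by have := hh x; positivity) (fun x => by rw [be_per, hηper])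
  simp only [one_div, inv_inv] at hΘd
  set c : ℝ → ℝ × ℝ := fun θ => (((η θ)⁻¹) ^ 2 * cos θ, ((η θ)⁻¹) ^ 2 * sin θ) with hc
  have hcper : ∀ θ, c (θ + 2 * π) = c θ := fun θ => by simp [hc, hηper]
  have hc0 : ∀ θ, c θ ≠ 0 := by
    intro θ h
    have h1 := congrArg Prod.fst h
    have h2 := congrArg Prod.snd h
    have := hηpos θ
    have := sin_sq_add_cos_sq θ
    simp [hc, (hηpos θ).ne'] at h1 h2
    rw [h1, h2] at this
    norm_num at this
  set φ : ℝ → ℝ × ℝ := fun t => c (Θ t) with hφ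
  have hsol : IsSolution X φ := by
    intro t
    have h1 := (hηd (Θ t)).comp t (hΘd t)
    have hne := (hηpos (Θ t)).ne'
    have hbne := (be_pos (Θ t)).ne'
    have h2 := (h1.fun_inv hne).fun_pow 2
    have h3 := (h2.fun_mul (hΘd t).cos).prodMk (h2.fun_mul (hΘd t).sin)
    refine HasDerivAt.congr_deriv (show HasDerivAt φ _ t from h3) (Eq.symm ?_)
    rw [hX]
    simp only [hφ, hc, Function.comp]
    rw [oddSqrt_mul _ _ (inv_pos.2 (hηpos _)), oddSqrt_mul _ _ (inv_pos.2 (hηpos _))]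
    have hp := sin_sq_add_cos_sq (Θ t)
    have hal : al (Θ t) = _ := rfl
    have hbe : be (Θ t) = _ := rfl
    conv_rhs at hal => unfold al
    conv_rhs at hbe => unfold be
    have e1 : oddSqrt (cos (Θ t)) - oddSqrt (sin (Θ t)) =
        al (Θ t) * cos (Θ t) - be (Θ t) * sin (Θ t) := by
      rw [hal, hbe]; linear_combination -(oddSqrt (cos (Θ t)) - oddSqrt (sin (Θ t))) * hp
    have e2 : oddSqrt (cos (Θ t)) + oddSqrt (sin (Θ t)) =
        al (Θ t) * sin (Θ t) + be (Θ t) * cos (Θ t) := by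
      rw [hal, hbe]; linear_combination -(oddSqrt (cos (Θ t)) + oddSqrt (sin (Θ t))) * hp
    rw [← mul_sub, ← mul_add, e1, e2]
    clear hal hbe e1 e2
    ext
    · simp only [show 2 - 1 = 1 from rfl, pow_one, Nat.cast_ofNat]
      field_simp
      ring
    · simp only [show 2 - 1 = 1 from rfl, pow_one, Nat.cast_ofNat]
      field_simp
      ring
  refine ⟨φ, ⟨⟨hsol, ⟨T, hT, fun t => by simp only [hφ, hΘT, hcper]⟩, ?_⟩, {z | z ≠ 0},
    isOpen_ne, ?_, ?_⟩, ?_⟩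
  · rintro ⟨k, hk⟩
    have h1 := hk (τ 0)
    have h2 := hk (τ (π / 2))
    rw [← h2] at h1
    simp only [hφ, hΘτ, hc] at h1
    have := congrArg Prod.fst h1
    simp [(hηpos 0).ne'] at this
  · rintro _ ⟨t, rfl⟩; exact hc0 _
  · rintro ψ ⟨hψ, ⟨P, hP, hψP⟩, -⟩ hU
    have hne : ∀ t, ψ t ≠ 0 := fun t => hU ⟨t, rfl⟩
    have hψc : Continuous ψ := continuous_iff_continuousAt.2 fun t => (hψ t).continuousAt
    have hosc := oddSqrt_cont
    have hsq : ∀ t, (ψ t).1 ^ 2 + (ψ t).2 ^ 2 ≠ 0 := by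
      intro t h
      apply hne t
      have h1 : (ψ t).1 = 0 := by nlinarith [sq_nonneg (ψ t).1, sq_nonneg (ψ t).2]
      have h2 : (ψ t).2 = 0 := by nlinarith [sq_nonneg (ψ t).1, sq_nonneg (ψ t).2]
      exact Prod.ext h1 h2
    have hXc : Continuous X := by
      have : X = fun z => (-z.1 + (oddSqrt z.1 - oddSqrt z.2),
        -z.2 + (oddSqrt z.1 + oddSqrt z.2)) := funext hX
      rw [this]; fun_prop
    have hx : ∀ t, HasDerivAt (fun t => (ψ t).1) (X (ψ t)).1 t := fun t => (hψ t).fst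
    have hy : ∀ t, HasDerivAt (fun t => (ψ t).2) (X (ψ t)).2 t := fun t => (hψ t).snd
    obtain ⟨l, Ψ, hl, hΨ, hpol⟩ := polar_lift (fun t => (ψ t).1) (fun t => (ψ t).2)
      (fun t => ((ψ t).1 * (X (ψ t)).1 + (ψ t).2 * (X (ψ t)).2) / ((ψ t).1 ^ 2 + (ψ t).2 ^ 2))
      (fun t => ((ψ t).1 * (X (ψ t)).2 - (ψ t).2 * (X (ψ t)).1) / ((ψ t).1 ^ 2 + (ψ t).2 ^ 2))
      (Continuous.div (by fun_prop) (by fun_prop) hsq)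
      (Continuous.div (by fun_prop) (by fun_prop) hsq)
      (fun t => by
        convert hx t using 1
        have := hsq t
        field_simp
        ring)
      (fun t => by
        convert hy t using 1
        have := hsq t
        field_simp
        ring)
      (by
        by_contra! h
        exact hne 0 (Prod.ext h.1 h.2))
    set ρ : ℝ → ℝ := fun t => exp (l t / 2) with hρ
    have hρpos : ∀ t, 0 < ρ t := fun t => exp_pos _
    have hρ2 : ∀ t, exp (l t) = ρ t ^ 2 := fun t => by
      simp only [hρ]; rw [sq, ← exp_add]; congr 1; ring
    simp only [hρ2] at hpol
    have hsqe : ∀ t, (ψ t).1 ^ 2 + (ψ t).2 ^ 2 = ρ t ^ 4 := by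
      intro t
      rw [(hpol t).1, (hpol t).2]
      linear_combination ρ t ^ 4 * sin_sq_add_cos_sq (Ψ t)
    have hl' : ∀ t, HasDerivAt l (-1 + al (Ψ t) / ρ t) t := by
      intro t
      convert hl t using 1
      have := (hρpos t).ne'
      rw [hsqe, hX, (hpol t).1, (hpol t).2, oddSqrt_mul _ _ (hρpos t), oddSqrt_mul _ _ (hρpos t)]
      unfold al
      field_simp
      linear_combination ρ t * sin_sq_add_cos_sq (Ψ t)
    have hΨ' : ∀ t, HasDerivAt Ψ (be (Ψ t) / ρ t) t := by
      intro t
      convert hΨ t using 1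
      have := (hρpos t).ne'
      rw [hsqe, hX, (hpol t).1, (hpol t).2, oddSqrt_mul _ _ (hρpos t), oddSqrt_mul _ _ (hρpos t)]
      unfold be
      field_simp
      ring
    -- the function `G = ρ η(Ψ)`
    have hG : ∀ t, HasDerivAt (fun t => exp (t / 2) * (ρ t * η (Ψ t) - 1)) 0 t := by
      intro t
      have h1 : HasDerivAt ρ (exp (l t / 2) * ((-1 + al (Ψ t) / ρ t) / 2)) t :=
        ((hl' t).div_const 2).exp
      have h2 := (hηd (Ψ t)).comp t (hΨ' t)
      have h3 := (((hasDerivAt_id t).div_const 2).exp).fun_mul ((h1.fun_mul h2).sub_const 1)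
      refine HasDerivAt.congr_deriv h3 (Eq.symm ?_)
      have h4 : exp (l t / 2) = ρ t := rfl
      rw [h4]
      have := (hρpos t).ne'
      have := (be_pos (Ψ t)).ne'
      simp only [Function.comp, id]
      field_simp
      ring
    -- `G` only depends on the point
    have hηP : Function.Periodic η (2 * π) := hηper
    have hGper : ∀ t, ρ (t + P) * η (Ψ (t + P)) = ρ t * η (Ψ t) := by
      intro t
      have e := hψP t
      have hr : ρ (t + P) = ρ t := by
        have h1 := hsqe (t + P)
        rw [e, hsqe t] at h1
        exact ((pow_left_inj₀ (hρpos _).le (hρpos _).le (by norm_num)).1 h1).symm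
      have hcos : cos (Ψ (t + P)) = cos (Ψ t) := by
        have h1 := (hpol (t + P)).1
        rw [e, (hpol t).1, hr] at h1
        have := (hρpos t).ne'
        field_simp at h1
        exact h1.symm
      have hsin : sin (Ψ (t + P)) = sin (Ψ t) := by
        have h1 := (hpol (t + P)).2
        rw [e, (hpol t).2, hr] at h1
        have := (hρpos t).ne'
        field_simp at h1
        exact h1.symm
      have hang := Real.Angle.cos_sin_inj hcos hsin
      rw [Real.Angle.angle_eq_iff_two_pi_dvd_sub] at hang
      obtain ⟨k, hk⟩ := hang
      have : Ψ (t + P) = Ψ t + k * (2 * π) := by linarith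
      rw [hr, this, hηP.int_mul k]
    have hG1 : ∀ t, ρ t * η (Ψ t) = 1 := by
      intro t
      have h1 := const_of_deriv hG (t + P) t
      simp only [hGper] at h1
      have h2 : exp (t / 2) < exp ((t + P) / 2) := exp_lt_exp.2 (by linarith)
      have h3 : (exp ((t + P) / 2) - exp (t / 2)) * (ρ t * η (Ψ t) - 1) = 0 := by linarith
      rcases mul_eq_zero.1 h3 with h | h <;> linarith
    have hρη : ∀ t, ρ t = (η (Ψ t))⁻¹ := fun t => eq_inv_of_mul_eq_one_left (hG1 t)
    have hψc : ∀ t, ψ t = c (Ψ t) := by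
      intro t
      apply Prod.ext
      · rw [(hpol t).1, hρη]
      · rw [(hpol t).2, hρη]
    have htime : ∀ t, HasDerivAt (fun t => τ (Ψ t) - t) 0 t := by
      intro t
      have h1 := ((hτd (Ψ t)).comp t (hΨ' t)).fun_sub (hasDerivAt_id t)
      refine HasDerivAt.congr_deriv h1 (Eq.symm ?_)
      rw [hρη]
      have := (hηpos (Ψ t)).ne'
      have := (be_pos (Ψ t)).ne'
      field_simp
      ring
    have hshift : ∀ t, ψ t = φ (t + τ (Ψ 0)) := by
      intro t
      have h1 := const_of_deriv htime t 0
      have h2 : τ (Ψ t) = t + τ (Ψ 0) := by linarith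
      rw [hψc, ← h2]
      simp only [hφ, hΘτ]
    ext z
    constructor
    · rintro ⟨t, rfl⟩; exact ⟨_, (hshift t).symm⟩
    · rintro ⟨t, rfl⟩
      exact ⟨t - τ (Ψ 0), by rw [hshift]; congr 1; ring⟩
  · refine ⟨φ (τ 0), ⟨_, rfl⟩, ?_⟩
    simp [hφ, hΘτ, hc]

/-- There exist real parameters with
`(p₁₁ + p₂₂)(q₁₁ + q₂₂) ≠ 0` such that the planar system
`ẋ = s₁ + q₁₁√(x) + q₁₂√(y) + p₁₁x + p₁₂y`,
`ẏ = s₂ + q₂₁√(x) + q₂₂√(y) + p₂₁x + p₂₂y`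
has at least one limit cycle, and this limit cycle crosses the set `Σ = {xy = 0}`. -/
theorem statement9 :
    ∃ s₁ s₂ q₁₁ q₁₂ q₂₁ q₂₂ p₁₁ p₁₂ p₂₁ p₂₂ : ℝ,
      (p₁₁ + p₂₂) * (q₁₁ + q₂₂) ≠ 0 ∧
      ∃ φ : ℝ → ℝ × ℝ,
        IsLimitCycle
          (fun z : ℝ × ℝ =>
            ((s₁ + q₁₁ * oddSqrt z.1 + q₁₂ * oddSqrt z.2 + p₁₁ * z.1 + p₁₂ * z.2,
              s₂ + q₂₁ * oddSqrt z.1 + q₂₂ * oddSqrt z.2 + p₂₁ * z.1 + p₂₂ * z.2) : ℝ × ℝ))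
          φ ∧
        (Set.range φ ∩ {z : ℝ × ℝ | z.1 * z.2 = 0}).Nonempty := by
  refine ⟨0, 0, 1, -1, 1, 1, -1, 0, 0, -1, by norm_num, ?_⟩
  apply main_cycle
  intro z
  ext
  · simp only; ring
  · simp only; ring
end
end

section
/- There exist real parameters s_1, s_2, p_{1,1}, p_{1,2}, p_{2,1}, p_{2,2}, q_{1,1}, q_{1,2}, q_{2,1}, q_{2,2} such that the planar system ẋ = s_1 + p_{1,1}x + p_{1,2}y + q_{1,1}·x^{1/3} + q_{1,2}·√(y), ẏ = s_2 + p_{2,1}x + p_{2,2}y + q_{2,1}·x^{1/3} + q_{2,2}·√(y) has at least two limit cycles crossing the set Σ = {(x,y) : xy = 0}. -/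
open Real Set

noncomputable section

/-- The real (odd) cube root: `sgn(z)·|z|^{1/3}`. -/
def cbrt (z : ℝ) : ℝ := Real.sign z * |z| ^ ((1:ℝ) / 3)


/-! ### Part 1: the cube root -/

lemma cbrt_pow3 (z : ℝ) : cbrt z ^ 3 = z := by
  unfold cbrt
  have h : (|z| ^ ((1:ℝ) / 3)) ^ 3 = |z| := by
    rw [← Real.rpow_natCast, ← Real.rpow_mul (abs_nonneg z)]
    norm_num
  rw [mul_pow, h]
  rcases lt_trichotomy z 0 with hz | hz | hz
  · rw [Real.sign_of_neg hz, abs_of_neg hz]; ring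
  · subst hz; simp
  · rw [Real.sign_of_pos hz, abs_of_pos hz]; ring

lemma pow3_le {a b : ℝ} : a ^ 3 ≤ b ^ 3 ↔ a ≤ b := (Odd.strictMono_pow (by decide : Odd 3)).le_iff_le

lemma pow3_lt {a b : ℝ} : a ^ 3 < b ^ 3 ↔ a < b := (Odd.strictMono_pow (by decide : Odd 3)).lt_iff_lt

lemma pow3_inj {a b : ℝ} : a ^ 3 = b ^ 3 ↔ a = b := (Odd.strictMono_pow (by decide : Odd 3)).injective.eq_iff

lemma cbrt_cube (u : ℝ) : cbrt (u ^ 3) = u := pow3_inj.1 (cbrt_pow3 _)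

lemma cbrt_le {a b : ℝ} : cbrt a ≤ cbrt b ↔ a ≤ b := by
  rw [← pow3_le, cbrt_pow3, cbrt_pow3]

lemma cbrt_lt {a b : ℝ} : cbrt a < cbrt b ↔ a < b := by
  rw [← pow3_lt, cbrt_pow3, cbrt_pow3]

lemma cbrt_zero : cbrt 0 = 0 := by simp [cbrt]

lemma cbrt_neg (z : ℝ) : cbrt (-z) = - cbrt z := by
  apply pow3_inj.1
  rw [cbrt_pow3, Odd.neg_pow (by decide : Odd 3), cbrt_pow3]

lemma cbrt_mono : Monotone cbrt := fun _ _ h => cbrt_le.2 h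

lemma cbrt_surj : Function.Surjective cbrt := fun u => ⟨u ^ 3, cbrt_cube u⟩

lemma cbrt_cont : Continuous cbrt := cbrt_mono.continuous_of_surjective cbrt_surj

lemma cbrt_pos {x : ℝ} : 0 < cbrt x ↔ 0 < x := by
  have := @cbrt_lt 0 x; rwa [cbrt_zero] at this

lemma cbrt_le_iff {x u : ℝ} : cbrt x ≤ u ↔ x ≤ u ^ 3 := by
  rw [← pow3_le, cbrt_pow3]

lemma le_cbrt_iff {x u : ℝ} : u ≤ cbrt x ↔ u ^ 3 ≤ x := by
  rw [← pow3_le, cbrt_pow3]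

lemma cbrt_sub_cube (a b : ℝ) : |cbrt a - cbrt b| ^ 3 ≤ 4 * |a - b| := by
  have ha := cbrt_pow3 a
  have hb := cbrt_pow3 b
  set p := cbrt a
  set q := cbrt b
  have h1 : a - b = (p - q) * (p ^ 2 + p * q + q ^ 2) := by rw [← ha, ← hb]; ring
  have h2 : 0 ≤ p ^ 2 + p * q + q ^ 2 := by nlinarith [sq_nonneg (p + q), sq_nonneg p, sq_nonneg q]
  rw [h1, abs_mul, abs_of_nonneg h2]
  have h3 : |p - q| ^ 2 ≤ 4 * (p ^ 2 + p * q + q ^ 2) := by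
    rw [sq_abs]; nlinarith [sq_nonneg (p + q)]
  calc |p - q| ^ 3 = |p - q| * |p - q| ^ 2 := by ring
    _ ≤ |p - q| * (4 * (p ^ 2 + p * q + q ^ 2)) := by gcongr
    _ = _ := by ring

lemma cbrt_unif : UniformContinuous cbrt := by
  rw [Metric.uniformContinuous_iff]
  intro ε hε
  refine ⟨ε ^ 3 / 4, by positivity, ?_⟩
  intro a b hab
  rw [Real.dist_eq] at *
  by_contra hc
  push Not at hc
  have h1 := cbrt_sub_cube a b
  have h2 : ε ^ 3 ≤ |cbrt a - cbrt b| ^ 3 := by gcongr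
  linarith

lemma cbrt_hasDerivAt {x : ℝ} (hx : x ≠ 0) :
    HasDerivAt cbrt (3 * cbrt x ^ 2)⁻¹ x := by
  have hu : cbrt x ≠ 0 := by
    intro h; apply hx; rw [← cbrt_pow3 x, h]; norm_num
  have h1 : HasDerivAt (fun u : ℝ => u ^ 3) (3 * cbrt x ^ 2) (cbrt x) := by
    have := hasDerivAt_pow 3 (cbrt x)
    norm_num at this
    exact this
  exact HasDerivAt.of_local_left_inverse cbrt_cont.continuousAt h1 (by positivity)
    (Filter.Eventually.of_forall cbrt_pow3)

lemma oddSqrt_of_pos {y : ℝ} (hy : 0 < y) : oddSqrt y = √y := by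
  unfold oddSqrt; rw [Real.sign_of_pos hy, abs_of_pos hy, one_mul]

lemma oddSqrt_neg (y : ℝ) : oddSqrt (-y) = - oddSqrt y := by
  unfold oddSqrt; rw [Real.sign_neg, abs_neg]; ring

/-! ### Part 2: the clamped field and the dissipative estimate -/

/-- clamp of the first coordinate -/
def cx (x : ℝ) : ℝ := max (-8) (min x 8)
/-- clamp of the second coordinate -/
def cy (y : ℝ) : ℝ := max (1/16) (min y 16)

lemma cx_mono : Monotone cx := fun a b h => by unfold cx; gcongr
lemma cx_bd (x : ℝ) : -8 ≤ cx x ∧ cx x ≤ 8 :=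
  ⟨le_max_left _ _, max_le (by norm_num) (min_le_right _ _)⟩
lemma cy_bd (x : ℝ) : 1/16 ≤ cy x ∧ cy x ≤ 16 :=
  ⟨le_max_left _ _, max_le (by norm_num) (min_le_right _ _)⟩
lemma cx_cont : Continuous cx := by unfold cx; fun_prop
lemma cy_cont : Continuous cy := by unfold cy; fun_prop
lemma clamp_lip (p q a b : ℝ) : |max p (min a q) - max p (min b q)| ≤ |a - b| := by
  have h1 := abs_max_sub_max_le_max p (min a q) p (min b q)
  have h2 := abs_min_sub_min_le_max a q b q
  simp only [sub_self, abs_zero] at h1 h2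
  refine h1.trans (max_le (abs_nonneg _) (h2.trans (max_le le_rfl (abs_nonneg _))))
lemma cx_lip (a b : ℝ) : |cx a - cx b| ≤ |a - b| := clamp_lip _ _ a b
lemma cy_lip (a b : ℝ) : |cy a - cy b| ≤ |a - b| := clamp_lip _ _ a b
lemma cx_eq {x : ℝ} (h1 : -8 ≤ x) (h2 : x ≤ 8) : cx x = x := by
  unfold cx; rw [min_eq_left h2, max_eq_right h1]
lemma cy_eq {x : ℝ} (h1 : 1/16 ≤ x) (h2 : x ≤ 16) : cy x = x := by
  unfold cy; rw [min_eq_left h2, max_eq_right h1]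

/-- first component of the field, with `f` in the role of the cube root -/
def FX (f : ℝ → ℝ) (x y : ℝ) : ℝ := -3 * f x + cx x + 8 * (cy y - √(cy y))
/-- second component of the field -/
def FY (x y : ℝ) : ℝ := cy y - √(cy y) / 2 - cx x

lemma sqrt_cy_lip (a b : ℝ) : |√(cy a) - √(cy b)| ≤ 2 * |a - b| := by
  have ha := cy_bd a
  have hb := cy_bd b
  have h1 : (1/4 : ℝ) ≤ √(cy a) := Real.le_sqrt_of_sq_le (by linarith)
  have h2 : (1/4 : ℝ) ≤ √(cy b) := Real.le_sqrt_of_sq_le (by linarith)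
  have h3 : (√(cy a) - √(cy b)) * (√(cy a) + √(cy b)) = cy a - cy b := by
    have := Real.sq_sqrt (show 0 ≤ cy a by linarith)
    have := Real.sq_sqrt (show 0 ≤ cy b by linarith)
    nlinarith
  have h4 := cy_lip a b
  rw [← h3, abs_mul, abs_of_pos (show 0 < √(cy a) + √(cy b) by linarith)] at h4
  nlinarith [abs_nonneg (√(cy a) - √(cy b))]

lemma dissip (f g : ℝ → ℝ) (hf : Monotone f) (ε : ℝ) (hfg : ∀ x, |f x - g x| ≤ ε)
    (x y x' y' : ℝ) :
    2 * (x - x') * (FX f x y - FX g x' y') + 2 * (y - y') * (FY x y - FY x' y')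
      ≤ 40 * ((x - x') ^ 2 + (y - y') ^ 2 + ε ^ 2) := by
  unfold FX FY
  have e1 : -3 * (x - x') * (f x - f x') ≤ 0 := by
    rcases le_total x x' with h | h
    · have := hf h; nlinarith
    · have := hf h; nlinarith
  have e2 := hfg x'
  have e3 := cx_lip x x'
  have e4 := cy_lip y y'
  have e5 := sqrt_cy_lip y y'
  set P := x - x' with hP
  set Q := y - y' with hQ
  have m1 : -3 * P * (f x' - g x') ≤ 3 * (|P| * ε) := by
    calc -3 * P * (f x' - g x') ≤ |-3 * P * (f x' - g x')| := le_abs_self _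
      _ = 3 * (|P| * |f x' - g x'|) := by rw [abs_mul, abs_mul]; norm_num; ring
      _ ≤ _ := by gcongr
  have key : ∀ a b c d : ℝ, |b| ≤ c * |d| → a * b ≤ c * (|a| * |d|) := by
    intro a b c d h
    calc a * b ≤ |a * b| := le_abs_self _
      _ = |a| * |b| := abs_mul _ _
      _ ≤ |a| * (c * |d|) := by gcongr
      _ = _ := by ring
  have m2 := key P (cx x - cx x') 1 P (by linarith)
  have m3 := key P (cy y - cy y') 1 Q (by linarith)
  have m4 := key P (-(√(cy y) - √(cy y'))) 2 Q (by rw [abs_neg]; exact e5)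
  have m5 := key Q (cy y - cy y') 1 Q (by linarith)
  have m6 := key Q (-(√(cy y) - √(cy y'))) 2 Q (by rw [abs_neg]; exact e5)
  have m7 := key Q (-(cx x - cx x')) 1 P (by rw [abs_neg]; linarith)
  have s1 := sq_abs P
  have s2 := sq_abs Q
  have hp := abs_nonneg P
  have hq := abs_nonneg Q
  have hgoal : 2 * P * (-3 * f x + cx x + 8 * (cy y - √(cy y)) - (-3 * g x' + cx x' + 8 * (cy y' - √(cy y'))))
      + 2 * Q * (cy y - √(cy y) / 2 - cx x - (cy y' - √(cy y') / 2 - cx x'))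
     = 2 * (-3 * P * (f x - f x')) + 2 * (-3 * P * (f x' - g x')) + 2 * (P * (cx x - cx x'))
      + 16 * (P * (cy y - cy y')) + 16 * (P * (-(√(cy y) - √(cy y')))) + 2 * (Q * (cy y - cy y'))
      + (Q * (-(√(cy y) - √(cy y')))) + 2 * (Q * (-(cx x - cx x'))) := by ring
  rw [hgoal]
  nlinarith [sq_nonneg (|P| - |Q|), sq_nonneg (|P| - ε)]

/-- comparison of solutions on an interval -/
lemma cmp_sol (f g : ℝ → ℝ) (hf : Monotone f) (ε : ℝ) (hfg : ∀ x, |f x - g x| ≤ ε)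
    (x y x' y' : ℝ → ℝ) (a b : ℝ) (hab : a ≤ b)
    (hx : ∀ t ∈ Icc a b, HasDerivAt x (FX f (x t) (y t)) t)
    (hy : ∀ t ∈ Icc a b, HasDerivAt y (FY (x t) (y t)) t)
    (hx' : ∀ t ∈ Icc a b, HasDerivAt x' (FX g (x' t) (y' t)) t)
    (hy' : ∀ t ∈ Icc a b, HasDerivAt y' (FY (x' t) (y' t)) t) :
    (x b - x' b) ^ 2 + (y b - y' b) ^ 2 ≤
      ((x a - x' a) ^ 2 + (y a - y' a) ^ 2 + ε ^ 2) * Real.exp (40 * (b - a)) := by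
  set E : ℝ → ℝ := fun t => ((x t - x' t) ^ 2 + (y t - y' t) ^ 2 + ε ^ 2) * Real.exp (-(40 * t)) with hE
  have hd : ∀ t ∈ Icc a b, HasDerivAt E
      ((2 * (x t - x' t) * (FX f (x t) (y t) - FX g (x' t) (y' t)) +
        2 * (y t - y' t) * (FY (x t) (y t) - FY (x' t) (y' t))) * Real.exp (-(40 * t)) +
        ((x t - x' t) ^ 2 + (y t - y' t) ^ 2 + ε ^ 2) * (Real.exp (-(40 * t)) * (-(40 * 1)))) t := by
    intro t ht
    have h1 : HasDerivAt (fun t => (x t - x' t) ^ 2) _ t := ((hx t ht).sub (hx' t ht)).pow 2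
    have h1b : HasDerivAt (fun t => (y t - y' t) ^ 2) _ t := ((hy t ht).sub (hy' t ht)).pow 2
    have h2 : HasDerivAt (fun t => Real.exp (-(40 * t))) (Real.exp (-(40 * t)) * (-(40 * 1))) t :=
      (((hasDerivAt_id t).const_mul 40).neg).exp
    have h3 : HasDerivAt (fun t => ((x t - x' t) ^ 2 + (y t - y' t) ^ 2 + ε ^ 2) * Real.exp (-(40 * t))) _ t :=
      ((h1.add h1b).add_const (ε ^ 2)).mul h2
    refine h3.congr_deriv ?_
    simp only [Pi.sub_apply, Pi.add_apply, Nat.cast_ofNat]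
    ring
  have hanti : AntitoneOn E (Icc a b) := by
    apply antitoneOn_of_deriv_nonpos (convex_Icc a b)
    · exact fun t ht => (hd t ht).continuousAt.continuousWithinAt
    · intro t ht
      rw [interior_Icc] at ht
      exact (hd t (Ioo_subset_Icc_self ht)).differentiableAt.differentiableWithinAt
    · intro t ht
      rw [interior_Icc] at ht
      rw [(hd t (Ioo_subset_Icc_self ht)).deriv]
      have := dissip f g hf ε hfg (x t) (y t) (x' t) (y' t)
      have hp := Real.exp_pos (-(40 * t))
      nlinarith
  have h := hanti (left_mem_Icc.2 hab) (right_mem_Icc.2 hab) hab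
  simp only [hE] at h
  have e1 : Real.exp (40 * (b - a)) = Real.exp (40 * b) * Real.exp (-(40 * a)) := by
    rw [← Real.exp_add]; congr 1; ring
  have e2 : Real.exp (-(40 * b)) * Real.exp (40 * b) = 1 := by
    rw [← Real.exp_add]; simp
  have hp := Real.exp_pos (40 * b)
  calc (x b - x' b) ^ 2 + (y b - y' b) ^ 2 ≤ (x b - x' b) ^ 2 + (y b - y' b) ^ 2 + ε ^ 2 := by nlinarith [sq_nonneg ε]
    _ = (((x b - x' b) ^ 2 + (y b - y' b) ^ 2 + ε ^ 2) * Real.exp (-(40 * b))) * Real.exp (40 * b) := by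
        rw [mul_assoc, e2, mul_one]
    _ ≤ (((x a - x' a) ^ 2 + (y a - y' a) ^ 2 + ε ^ 2) * Real.exp (-(40 * a))) * Real.exp (40 * b) := by gcongr
    _ = _ := by rw [e1]; ring

/-! ### Part 3: existence of solutions of the clamped system -/

/-- the clamped cube root -/
def cc (x : ℝ) : ℝ := cbrt (cx x)

lemma cc_mono : Monotone cc := fun _ _ h => cbrt_mono (cx_mono h)
lemma cc_cont : Continuous cc := cbrt_cont.comp cx_cont

/-- regularised cube root -/
def freg (e x : ℝ) : ℝ := cbrt (max (cx x) 0 + e ^ 3) - cbrt (max (-cx x) 0 + e ^ 3)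

lemma freg_mono (e : ℝ) : Monotone (freg e) := by
  intro a b h
  have h1 := cx_mono h
  unfold freg
  have h2 : max (cx a) 0 + e ^ 3 ≤ max (cx b) 0 + e ^ 3 := by gcongr
  have h3 : max (-cx b) 0 + e ^ 3 ≤ max (-cx a) 0 + e ^ 3 := by gcongr
  have := cbrt_mono h2
  have := cbrt_mono h3
  linarith

lemma freg_aux {e s : ℝ} (he : 0 < e) (hs : 0 ≤ s) :
    |cbrt (s + e ^ 3) - e - cbrt s| ≤ e := by
  have h1 : cbrt s ≤ cbrt (s + e ^ 3) := cbrt_mono (by have := pow_pos he 3; linarith)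
  have hs' : 0 ≤ cbrt s := by have := cbrt_mono hs; rwa [cbrt_zero] at this
  have h2 : cbrt (s + e ^ 3) ≤ cbrt s + e := by
    rw [cbrt_le_iff]
    have := cbrt_pow3 s
    nlinarith [mul_nonneg hs' he.le, mul_nonneg (mul_nonneg hs' he.le) he.le, mul_nonneg (mul_nonneg hs' he.le) hs']
  rw [abs_le]; constructor <;> linarith

lemma freg_close {e : ℝ} (he : 0 < e) (x : ℝ) : |freg e x - cc x| ≤ e := by
  unfold freg cc
  rcases le_total 0 (cx x) with h | h
  · rw [max_eq_left h, max_eq_right (by linarith : -cx x ≤ 0), zero_add, cbrt_cube]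
    exact freg_aux he h
  · rw [max_eq_right h, max_eq_left (by linarith : 0 ≤ -cx x), zero_add, cbrt_cube]
    have := freg_aux he (show 0 ≤ -cx x by linarith)
    rw [cbrt_neg] at this
    rw [← abs_neg]; convert this using 2; ring

lemma cbrt_lip_pos {e a b : ℝ} (he : 0 < e) (ha : e ^ 3 ≤ a) (hb : e ^ 3 ≤ b) :
    |cbrt a - cbrt b| ≤ (e ^ 2)⁻¹ * |a - b| := by
  have h1 := le_cbrt_iff.2 ha
  have h2 := le_cbrt_iff.2 hb
  have e1 := cbrt_pow3 a
  have e2 := cbrt_pow3 b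
  set p := cbrt a
  set q := cbrt b
  have h3 : a - b = (p - q) * (p ^ 2 + p * q + q ^ 2) := by rw [← e1, ← e2]; ring
  have h4 : e ^ 2 ≤ p ^ 2 + p * q + q ^ 2 := by nlinarith
  have h5 : 0 < e ^ 2 := by positivity
  rw [h3, abs_mul, abs_of_pos (h5.trans_le h4), inv_mul_eq_div, le_div_iff₀ h5]
  gcongr

lemma freg_lip {e : ℝ} (he : 0 < e) (a b : ℝ) :
    |freg e a - freg e b| ≤ 2 * (e ^ 2)⁻¹ * |a - b| := by
  unfold freg
  have h0 := cx_lip a b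
  have hi : 0 < (e ^ 2)⁻¹ := by positivity
  have k1 : |max (cx a) 0 - max (cx b) 0| ≤ |a - b| := (abs_max_sub_max_le_abs _ _ _).trans h0
  have k2 : |max (-cx a) 0 - max (-cx b) 0| ≤ |a - b| := by
    refine (abs_max_sub_max_le_abs _ _ _).trans ?_
    rw [show -cx a - -cx b = -(cx a - cx b) by ring, abs_neg]; exact h0
  have h1 := cbrt_lip_pos (a := max (cx a) 0 + e ^ 3) (b := max (cx b) 0 + e ^ 3) he
    (by have := le_max_right (cx a) 0; linarith) (by have := le_max_right (cx b) 0; linarith)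
  have h2 := cbrt_lip_pos (a := max (-cx a) 0 + e ^ 3) (b := max (-cx b) 0 + e ^ 3) he
    (by have := le_max_right (-cx a) 0; linarith) (by have := le_max_right (-cx b) 0; linarith)
  rw [add_sub_add_right_eq_sub] at h1 h2
  have h3 := h1.trans (mul_le_mul_of_nonneg_left k1 hi.le)
  have h4 := h2.trans (mul_le_mul_of_nonneg_left k2 hi.le)
  rw [abs_le] at *
  constructor <;> linarith [h3.1, h3.2, h4.1, h4.2]

lemma cc_bd (x : ℝ) : |cc x| ≤ 2 := by
  have := cx_bd x
  unfold cc
  rw [abs_le]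
  constructor
  · rw [le_cbrt_iff]; linarith
  · rw [cbrt_le_iff]; linarith

lemma FX_bd {f : ℝ → ℝ} {e : ℝ} (he : e ≤ 1) (hf : ∀ x, |f x - cc x| ≤ e) (x y : ℝ) :
    |FX f x y| ≤ 200 := by
  have h1 := abs_le.1 (hf x)
  have h2 := abs_le.1 (cc_bd x)
  have h3 := cx_bd x
  have h4 := cy_bd y
  have h5 : √(cy y) ≤ 4 := by rw [Real.sqrt_le_left (by norm_num)]; linarith
  have h6 := Real.sqrt_nonneg (cy y)
  unfold FX
  rw [abs_le]; constructor <;> linarith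

lemma FY_bd (x y : ℝ) : |FY x y| ≤ 200 := by
  have h3 := cx_bd x
  have h4 := cy_bd y
  have h5 : √(cy y) ≤ 4 := by rw [Real.sqrt_le_left (by norm_num)]; linarith
  have h6 := Real.sqrt_nonneg (cy y)
  unfold FY
  rw [abs_le]; constructor <;> linarith

lemma reg_sol {e : ℝ} (he : 0 < e) (he1 : e ≤ 1) (x0 y0 : ℝ) (T : ℝ) (hT : 0 < T) :
    ∃ x y : ℝ → ℝ, x 0 = x0 ∧ y 0 = y0 ∧
      (∀ t ∈ Icc 0 T, HasDerivAt x (FX (freg e) (x t) (y t)) t) ∧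
      (∀ t ∈ Icc 0 T, HasDerivAt y (FY (x t) (y t)) t) := by
  set F : ℝ × ℝ → ℝ × ℝ := fun z => (FX (freg e) z.1 z.2, FY z.1 z.2) with hF
  have hi : 0 < (e ^ 2)⁻¹ := by positivity
  have hlip : LipschitzWith (Real.toNNReal (6 * (e ^ 2)⁻¹ + 30)) F := by
    apply LipschitzWith.of_dist_le_mul
    intro z w
    rw [Real.coe_toNNReal _ (by positivity)]
    have hx : |z.1 - w.1| ≤ dist z w := by rw [Prod.dist_eq, Real.dist_eq]; exact le_max_left _ _
    have hy : |z.2 - w.2| ≤ dist z w := by rw [Prod.dist_eq, Real.dist_eq, Real.dist_eq]; exact le_max_right _ _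
    have h1 := (freg_lip he z.1 w.1).trans (mul_le_mul_of_nonneg_left hx (by positivity))
    have h2 := (cx_lip z.1 w.1).trans hx
    have h3 := (cy_lip z.2 w.2).trans hy
    have h4 := sqrt_cy_lip z.2 w.2
    have hd : 0 ≤ (e ^ 2)⁻¹ * dist z w := by positivity
    have hd' : 0 ≤ dist z w := by positivity
    rw [abs_le] at h1 h2 h3 h4
    rw [Prod.dist_eq (x := F z)]
    simp only [hF, Real.dist_eq, FX, FY]
    apply max_le
    · rw [abs_le]; constructor <;> linarith
    · rw [abs_le]; constructor <;> linarith
  have hP : IsPicardLindelof (fun _ : ℝ => F) (tmin := -1) (tmax := T + 1)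
      ⟨0, by constructor <;> linarith⟩ (x0, y0) (Real.toNNReal (200 * (T + 1))) 0 200
      (Real.toNNReal (6 * (e ^ 2)⁻¹ + 30)) := by
    apply IsPicardLindelof.of_time_independent
    · intro z _
      rw [Prod.norm_def]
      simp only [hF, Real.norm_eq_abs]
      exact max_le (FX_bd he1 (freg_close he) _ _) (FY_bd _ _)
    · exact hlip.lipschitzOnWith
    · rw [Real.coe_toNNReal _ (by positivity)]
      rw [max_eq_left (by simp; linarith)]
      simp
  obtain ⟨α, h0, h⟩ := hP.exists_eq_forall_mem_Icc_hasDerivWithinAt₀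
  have hd : ∀ t ∈ Icc 0 T, HasDerivAt α (F (α t)) t := fun t ht =>
    (h t ⟨by linarith [ht.1], by linarith [ht.2]⟩).hasDerivAt
      (Icc_mem_nhds (by linarith [ht.1]) (by linarith [ht.2]))
  refine ⟨fun t => (α t).1, fun t => (α t).2, ?_, ?_, ?_, ?_⟩
  · show (α 0).1 = x0
    rw [show α 0 = _ from h0]
  · show (α 0).2 = y0
    rw [show α 0 = _ from h0]
  · intro t ht; exact (hd t ht).fst
  · intro t ht; exact (hd t ht).snd

lemma FX_unif : UniformContinuous (fun z : ℝ × ℝ => FX cc z.1 z.2) := by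
  have h1 : UniformContinuous cx := by
    have : LipschitzWith 1 cx := LipschitzWith.of_dist_le_mul (fun a b => by simpa [Real.dist_eq] using cx_lip a b)
    exact this.uniformContinuous
  have h2 : UniformContinuous cy := by
    have : LipschitzWith 1 cy := LipschitzWith.of_dist_le_mul (fun a b => by simpa [Real.dist_eq] using cy_lip a b)
    exact this.uniformContinuous
  have h3 : UniformContinuous (fun y => √(cy y)) := by
    have : LipschitzWith 2 (fun y => √(cy y)) := LipschitzWith.of_dist_le_mul (fun a b => by simpa [Real.dist_eq] using sqrt_cy_lip a b)
    exact this.uniformContinuous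
  have h4 : UniformContinuous cc := cbrt_unif.comp h1
  unfold FX
  have a1 : UniformContinuous (fun z : ℝ × ℝ => -3 * cc z.1) :=
    Real.uniformContinuous_const_mul.comp (h4.comp uniformContinuous_fst)
  have a2 : UniformContinuous (fun z : ℝ × ℝ => cx z.1) := h1.comp uniformContinuous_fst
  have a3 : UniformContinuous (fun z : ℝ × ℝ => cy z.2 - √(cy z.2)) :=
    (h2.comp uniformContinuous_snd).sub (h3.comp uniformContinuous_snd)
  have a4 : UniformContinuous (fun z : ℝ × ℝ => 8 * (cy z.2 - √(cy z.2))) :=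
    Real.uniformContinuous_const_mul.comp a3
  exact (a1.add a2).add a4

lemma FY_unif : UniformContinuous (fun z : ℝ × ℝ => FY z.1 z.2) := by
  have h1 : UniformContinuous cx := by
    have : LipschitzWith 1 cx := LipschitzWith.of_dist_le_mul (fun a b => by simpa [Real.dist_eq] using cx_lip a b)
    exact this.uniformContinuous
  have h2 : UniformContinuous cy := by
    have : LipschitzWith 1 cy := LipschitzWith.of_dist_le_mul (fun a b => by simpa [Real.dist_eq] using cy_lip a b)
    exact this.uniformContinuous
  have h3 : UniformContinuous (fun y => √(cy y) / 2) := by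
    have : LipschitzWith 1 (fun y => √(cy y) / 2) := LipschitzWith.of_dist_le_mul (fun a b => by
      have := sqrt_cy_lip a b
      rw [Real.dist_eq, Real.dist_eq, show √(cy a) / 2 - √(cy b) / 2 = (√(cy a) - √(cy b)) / 2 by ring,
        abs_div, abs_two]
      simp; linarith)
    exact this.uniformContinuous
  unfold FY
  exact ((h2.comp uniformContinuous_snd).sub (h3.comp uniformContinuous_snd)).sub (h1.comp uniformContinuous_fst)

/-- solutions of the clamped system exist for positive times -/
lemma exists_sol (x0 y0 : ℝ) : ∃ x y : ℝ → ℝ,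
    (∀ t, 0 < t → HasDerivAt x (FX cc (x t) (y t)) t) ∧
    (∀ t, 0 < t → HasDerivAt y (FY (x t) (y t)) t) ∧
    (∀ t, 0 ≤ t → |x t - x0| ≤ 200 * t ∧ |y t - y0| ≤ 200 * t) := by
  set e : ℕ → ℝ := fun n => 1 / ((n : ℝ) + 1) with he
  have hepos : ∀ n, 0 < e n := fun n => by simp only [he]; positivity
  have hele : ∀ n, e n ≤ 1 := fun n => by
    simp only [he]; rw [div_le_one (by positivity)]
    have : (0:ℝ) ≤ n := Nat.cast_nonneg n
    linarith
  have heanti : ∀ n m, n ≤ m → e m ≤ e n := fun n m h => by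
    simp only [he]; gcongr
  have helim : Filter.Tendsto e Filter.atTop (nhds 0) := tendsto_one_div_add_atTop_nhds_zero_nat
  choose x y hx0 hy0 hx hy using fun n : ℕ =>
    reg_sol (hepos n) (hele n) x0 y0 ((n:ℝ) + 1) (by positivity)
  have hcmp : ∀ n m : ℕ, n ≤ m → ∀ T : ℝ, T ≤ n → ∀ t ∈ Icc 0 T,
      (x n t - x m t) ^ 2 + (y n t - y m t) ^ 2 ≤ (2 * e n * Real.exp (20 * T)) ^ 2 := by
    intro n m hnm T hT t ht
    have hnm' : (n:ℝ) ≤ m := by exact_mod_cast hnm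
    have hen := heanti n m hnm
    have h := cmp_sol (freg (e n)) (freg (e m)) (freg_mono _) (2 * e n) (fun z => by
        have h1 := abs_le.1 (freg_close (hepos n) z)
        have h2 := abs_le.1 (freg_close (hepos m) z)
        rw [abs_le]; constructor <;> linarith [h1.1, h1.2, h2.1, h2.2])
      (x n) (y n) (x m) (y m) 0 t ht.1
      (fun s hs => hx n s ⟨hs.1, by linarith [hs.2, ht.2]⟩)
      (fun s hs => hy n s ⟨hs.1, by linarith [hs.2, ht.2]⟩)
      (fun s hs => hx m s ⟨hs.1, by linarith [hs.2, ht.2]⟩)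
      (fun s hs => hy m s ⟨hs.1, by linarith [hs.2, ht.2]⟩)
    rw [hx0, hx0, hy0, hy0] at h
    have e1 : Real.exp (40 * (t - 0)) ≤ Real.exp (20 * T) ^ 2 := by
      rw [← Real.exp_nat_mul]; apply Real.exp_le_exp.2; push_cast; linarith [ht.2]
    calc _ ≤ _ := h
      _ = (2 * e n) ^ 2 * Real.exp (40 * (t - 0)) := by ring
      _ ≤ (2 * e n) ^ 2 * Real.exp (20 * T) ^ 2 := by gcongr
      _ = _ := by ring
  have hcx : ∀ n m : ℕ, n ≤ m → ∀ T : ℝ, T ≤ n → ∀ t ∈ Icc 0 T,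
      |x n t - x m t| ≤ 2 * e n * Real.exp (20 * T) := fun n m hnm T hT t ht => by
    have h := hcmp n m hnm T hT t ht
    have := hepos n
    exact abs_le_of_sq_le_sq (by nlinarith [sq_nonneg (y n t - y m t)]) (by positivity)
  have hcy : ∀ n m : ℕ, n ≤ m → ∀ T : ℝ, T ≤ n → ∀ t ∈ Icc 0 T,
      |y n t - y m t| ≤ 2 * e n * Real.exp (20 * T) := fun n m hnm T hT t ht => by
    have h := hcmp n m hnm T hT t ht
    have := hepos n
    exact abs_le_of_sq_le_sq (by nlinarith [sq_nonneg (x n t - x m t)]) (by positivity)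
  -- a general limit lemma
  have hlim : ∀ z : ℕ → ℝ → ℝ, (∀ n m : ℕ, n ≤ m → ∀ T : ℝ, T ≤ n → ∀ t ∈ Icc 0 T,
      |z n t - z m t| ≤ 2 * e n * Real.exp (20 * T)) → ∃ Z : ℝ → ℝ,
      (∀ t, 0 ≤ t → Filter.Tendsto (fun n => z n t) Filter.atTop (nhds (Z t))) ∧
      ∀ T : ℝ, TendstoUniformlyOn z Z Filter.atTop (Icc 0 T) := by
    intro z hz
    have hb : ∀ T : ℝ, Filter.Tendsto (fun n => 2 * e n * Real.exp (20 * T)) Filter.atTop (nhds 0) := by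
      intro T
      have := (helim.const_mul 2).mul_const (Real.exp (20 * T))
      simpa using this
    have hc : ∀ t, ∃ l, 0 ≤ t → Filter.Tendsto (fun n => z n t) Filter.atTop (nhds l) := by
      intro t
      by_cases ht : 0 ≤ t
      · have : CauchySeq (fun n => z n t) := by
          rw [Metric.cauchySeq_iff']
          intro ε hε
          have h1 := ((hb t).eventually (gt_mem_nhds hε)).and (Filter.eventually_ge_atTop ⌈t⌉₊)
          obtain ⟨N, hN1, hN2⟩ := h1.exists
          refine ⟨N, fun n hn => ?_⟩
          rw [dist_comm, Real.dist_eq]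
          exact (hz N n hn t ((Nat.le_ceil t).trans (by exact_mod_cast hN2)) t ⟨ht, le_rfl⟩).trans_lt hN1
        obtain ⟨l, hl⟩ := cauchySeq_tendsto_of_complete this
        exact ⟨l, fun _ => hl⟩
      · exact ⟨0, fun h => absurd h ht⟩
    choose Z hZ using hc
    refine ⟨Z, hZ, fun T => ?_⟩
    rw [Metric.tendstoUniformlyOn_iff]
    intro ε hε
    filter_upwards [(hb T).eventually (gt_mem_nhds hε), Filter.eventually_ge_atTop ⌈T⌉₊] with n hn1 hn2
    intro t ht
    refine lt_of_le_of_lt ?_ hn1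
    rw [dist_comm, Real.dist_eq]
    have h1 : Filter.Tendsto (fun m => |z n t - z m t|) Filter.atTop (nhds |z n t - Z t|) :=
      ((hZ t ht.1).const_sub (z n t)).abs
    refine le_of_tendsto h1 ?_
    filter_upwards [Filter.eventually_ge_atTop n] with m hm
    exact hz n m hm T ((Nat.le_ceil T).trans (by exact_mod_cast hn2)) t ht
  obtain ⟨X, hX1, hX2⟩ := hlim x hcx
  obtain ⟨Y, hY1, hY2⟩ := hlim y hcy
  have hpair : ∀ T : ℝ, TendstoUniformlyOn (fun n t => (x n t, y n t)) (fun t => (X t, Y t)) Filter.atTop (Ioo 0 T) := by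
    intro T
    have a1 := hX2 T
    have a2 := hY2 T
    rw [Metric.tendstoUniformlyOn_iff] at a1 a2 ⊢
    intro ε hε
    filter_upwards [a1 ε hε, a2 ε hε] with n h1 h2 t ht
    rw [Prod.dist_eq]
    exact max_lt (h1 t (Ioo_subset_Icc_self ht)) (h2 t (Ioo_subset_Icc_self ht))
  refine ⟨X, Y, ?_, ?_, ?_⟩
  · intro t ht
    have hu := FX_unif.comp_tendstoUniformlyOn (hpair (t + 1))
    have hu2 : TendstoUniformlyOn (fun n s => FX (freg (e n)) (x n s) (y n s))
        (fun s => FX cc (X s) (Y s)) Filter.atTop (Ioo 0 (t + 1)) := by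
      rw [Metric.tendstoUniformlyOn_iff] at hu ⊢
      intro ε hε
      have h6 : Filter.Tendsto (fun n => 3 * e n) Filter.atTop (nhds 0) := by simpa using helim.const_mul 3
      filter_upwards [hu (ε / 2) (by linarith), h6.eventually (gt_mem_nhds (half_pos hε))] with n h1 h2
      intro s hs
      have h3 := h1 s hs
      have h4 := freg_close (hepos n) (x n s)
      simp only [Function.comp, Real.dist_eq, FX] at h3 ⊢
      rw [abs_le] at h4
      rw [abs_lt] at h3 ⊢
      constructor <;> linarith [h3.1, h3.2, h4.1, h4.2]
    refine hasDerivAt_of_tendstoUniformlyOn (s := Ioo 0 (t + 1)) isOpen_Ioo hu2 ?_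
      (fun s hs => hX1 s hs.1.le) ⟨ht, by linarith⟩
    filter_upwards [Filter.eventually_ge_atTop ⌈t⌉₊] with n hn s hs
    have : t ≤ n := (Nat.le_ceil t).trans (by exact_mod_cast hn)
    exact hx n s ⟨hs.1.le, by linarith [hs.2]⟩
  · intro t ht
    have hu := FY_unif.comp_tendstoUniformlyOn (hpair (t + 1))
    refine hasDerivAt_of_tendstoUniformlyOn (s := Ioo 0 (t + 1)) isOpen_Ioo hu ?_
      (fun s hs => hY1 s hs.1.le) ⟨ht, by linarith⟩
    filter_upwards [Filter.eventually_ge_atTop ⌈t⌉₊] with n hn s hs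
    have : t ≤ n := (Nat.le_ceil t).trans (by exact_mod_cast hn)
    exact hy n s ⟨hs.1.le, by linarith [hs.2]⟩
  · intro t ht
    have hbx : ∀ n : ℕ, t ≤ n → |x n t - x0| ≤ 200 * t ∧ |y n t - y0| ≤ 200 * t := by
      intro n hn
      constructor
      · have := Convex.norm_image_sub_le_of_norm_hasDerivWithin_le (s := Icc 0 t)
          (fun s hs => (hx n s ⟨hs.1, by linarith [hs.2]⟩).hasDerivWithinAt)
          (fun s _ => by rw [Real.norm_eq_abs]; exact FX_bd (hele n) (freg_close (hepos n)) _ _)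
          (convex_Icc 0 t) (left_mem_Icc.2 ht) (right_mem_Icc.2 ht)
        rw [hx0, Real.norm_eq_abs, Real.norm_eq_abs, sub_zero, abs_of_nonneg ht] at this
        exact this
      · have := Convex.norm_image_sub_le_of_norm_hasDerivWithin_le (s := Icc 0 t)
          (fun s hs => (hy n s ⟨hs.1, by linarith [hs.2]⟩).hasDerivWithinAt)
          (fun s _ => by rw [Real.norm_eq_abs]; exact FY_bd _ _)
          (convex_Icc 0 t) (left_mem_Icc.2 ht) (right_mem_Icc.2 ht)
        rw [hy0, Real.norm_eq_abs, Real.norm_eq_abs, sub_zero, abs_of_nonneg ht] at this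
        exact this
    have hev : ∀ᶠ n : ℕ in Filter.atTop, t ≤ n := by
      filter_upwards [Filter.eventually_ge_atTop ⌈t⌉₊] with n hn
      exact (Nat.le_ceil t).trans (by exact_mod_cast hn)
    exact ⟨le_of_tendsto ((hX1 t ht).sub_const x0).abs (hev.mono fun n hn => (hbx n hn).1),
      le_of_tendsto ((hY1 t ht).sub_const y0).abs (hev.mono fun n hn => (hbx n hn).2)⟩

/-! ### Part 4: trapping lemmas -/

/-- `(x,y)` solves the clamped system on `[a,∞)` -/
def Sol (a : ℝ) (x y : ℝ → ℝ) : Prop :=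
  ∀ t, a ≤ t → HasDerivAt x (FX cc (x t) (y t)) t ∧ HasDerivAt y (FY (x t) (y t)) t

/-- the region where all the action takes place -/
def Bx (x y : ℝ) : Prop := -3 ≤ x ∧ x ≤ 3 ∧ 1/4 ≤ y ∧ y ≤ 2

lemma FX_eq {x y : ℝ} (h : Bx x y) : FX cc x y = -3 * cbrt x + x + 8 * (y - √y) := by
  obtain ⟨h1, h2, h3, h4⟩ := h
  unfold FX cc
  rw [cx_eq (by linarith) (by linarith), cy_eq (by linarith) (by linarith)]

lemma FY_eq {x y : ℝ} (h : Bx x y) : FY x y = y - √y / 2 - x := by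
  obtain ⟨h1, h2, h3, h4⟩ := h
  unfold FY
  rw [cx_eq (by linarith) (by linarith), cy_eq (by linarith) (by linarith)]

lemma Sol.mono {a b : ℝ} {x y : ℝ → ℝ} (h : Sol a x y) (hab : a ≤ b) : Sol b x y :=
  fun t ht => h t (hab.trans ht)

lemma pos_right {g : ℝ → ℝ} {d t : ℝ} (hd : 0 < d) (h0 : g t = 0) (h : HasDerivAt g d t) :
    ∀ᶠ s in nhdsWithin t (Ioi t), 0 < g s := by
  have h1 := hasDerivAt_iff_tendsto_slope.1 h
  have h2 : Filter.Tendsto (slope g t) (nhdsWithin t (Ioi t)) (nhds d) :=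
    h1.mono_left (nhdsWithin_mono _ (fun s (hs : t < s) => ne_of_gt hs))
  filter_upwards [h2.eventually (lt_mem_nhds hd), self_mem_nhdsWithin] with s hs hts
  rw [slope_def_field, h0, sub_zero] at hs
  have : 0 < s - t := sub_pos.2 hts
  have h3 := mul_pos hs this
  rwa [div_mul_cancel₀ _ this.ne'] at h3

/-- trajectories in a region bounded by three repelling walls reach the exit `h = 0` -/
lemma stage (g1 g2 g3 h p : ℝ → ℝ) (t0 δ M : ℝ) (hδ : 0 < δ)
    (i1 : 0 ≤ g1 t0) (i2 : 0 ≤ g2 t0) (i3 : 0 ≤ g3 t0) (ih : 0 ≤ h t0)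
    (c1 : ∀ t, t0 ≤ t → ContinuousAt g1 t) (c2 : ∀ t, t0 ≤ t → ContinuousAt g2 t)
    (c3 : ∀ t, t0 ≤ t → ContinuousAt g3 t) (ch : ∀ t, t0 ≤ t → ContinuousAt h t)
    (w1 : ∀ t, t0 ≤ t → 0 ≤ g2 t → 0 ≤ g3 t → 0 < h t → g1 t = 0 → ∃ d, 0 < d ∧ HasDerivAt g1 d t)
    (w2 : ∀ t, t0 ≤ t → 0 ≤ g1 t → 0 ≤ g3 t → 0 < h t → g2 t = 0 → ∃ d, 0 < d ∧ HasDerivAt g2 d t)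
    (w3 : ∀ t, t0 ≤ t → 0 ≤ g1 t → 0 ≤ g2 t → 0 < h t → g3 t = 0 → ∃ d, 0 < d ∧ HasDerivAt g3 d t)
    (pr : ∀ t, t0 ≤ t → 0 ≤ g1 t → 0 ≤ g2 t → 0 ≤ g3 t → 0 < h t →
      p t ≤ M ∧ ∃ d, δ ≤ d ∧ HasDerivAt p d t) :
    ∃ t1, t0 ≤ t1 ∧ h t1 = 0 ∧
      (∀ t ∈ Icc t0 t1, 0 ≤ g1 t ∧ 0 ≤ g2 t ∧ 0 ≤ g3 t ∧ 0 ≤ h t) ∧ (∀ t ∈ Ico t0 t1, 0 < h t) := by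
  set B : Set ℝ := {t | t0 ≤ t ∧ ¬ (0 ≤ g1 t ∧ 0 ≤ g2 t ∧ 0 ≤ g3 t ∧ 0 < h t)} with hB
  have hne : B.Nonempty := by
    by_contra hc
    have hgood : ∀ t, t0 ≤ t → 0 ≤ g1 t ∧ 0 ≤ g2 t ∧ 0 ≤ g3 t ∧ 0 < h t := by
      intro t ht
      by_contra hn
      exact hc ⟨t, ht, hn⟩
    have hpr : ∀ t, t0 ≤ t → p t ≤ M ∧ ∃ d, δ ≤ d ∧ HasDerivAt p d t := fun t ht => by
      obtain ⟨a, b, c, d⟩ := hgood t ht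
      exact pr t ht a b c d
    set T := t0 + (M - p t0) / δ + 1 with hT
    have hM := (hpr t0 le_rfl).1
    have hT0 : t0 ≤ T := by
      have : 0 ≤ (M - p t0) / δ := div_nonneg (by linarith) hδ.le
      linarith
    have hmono : MonotoneOn (fun t => p t - δ * t) (Icc t0 T) := by
      have hd : ∀ t, t0 ≤ t → ∃ d, 0 ≤ d ∧ HasDerivAt (fun t => p t - δ * t) d t := by
        intro t ht
        obtain ⟨d, hd, hd'⟩ := (hpr t ht).2
        refine ⟨d - δ * 1, by linarith, hd'.sub ((hasDerivAt_id t).const_mul δ)⟩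
      apply monotoneOn_of_deriv_nonneg (convex_Icc t0 T)
      · intro t ht
        obtain ⟨d, _, hd'⟩ := hd t ht.1
        exact hd'.continuousAt.continuousWithinAt
      · intro t ht
        rw [interior_Icc] at ht
        obtain ⟨d, _, hd'⟩ := hd t ht.1.le
        exact hd'.differentiableAt.differentiableWithinAt
      · intro t ht
        rw [interior_Icc] at ht
        obtain ⟨d, hd0, hd'⟩ := hd t ht.1.le
        rw [hd'.deriv]; exact hd0
    have h1 := hmono (left_mem_Icc.2 hT0) (right_mem_Icc.2 hT0) hT0
    have h2 := (hpr T hT0).1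
    have h3 : δ * (T - t0) = M - p t0 + δ := by rw [hT]; field_simp; ring
    simp only at h1
    nlinarith
  have hbdd : BddBelow B := ⟨t0, fun t ht => ht.1⟩
  set c := sInf B with hc
  have hc0 : t0 ≤ c := le_csInf hne (fun t ht => ht.1)
  have hlt : ∀ t, t0 ≤ t → t < c → 0 ≤ g1 t ∧ 0 ≤ g2 t ∧ 0 ≤ g3 t ∧ 0 < h t := by
    intro t ht htc
    by_contra hn
    exact absurd (csInf_le hbdd (show t ∈ B from ⟨ht, hn⟩)) (not_le.2 htc)
  have hclose : ∀ f : ℝ → ℝ, 0 ≤ f t0 → ContinuousAt f c → (∀ t, t0 ≤ t → t < c → 0 ≤ f t) → 0 ≤ f c := by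
    intro f hf0 hfc hf
    rcases hc0.eq_or_lt with heq | hlt'
    · rw [← heq]; exact hf0
    · refine ge_of_tendsto (hfc.tendsto.mono_left (nhdsWithin_le_nhds (s := Iio c))) ?_
      filter_upwards [Ico_mem_nhdsLT hlt'] with t ht
      exact hf t ht.1 ht.2
  have k1 := hclose g1 i1 (c1 c hc0) (fun t a b => (hlt t a b).1)
  have k2 := hclose g2 i2 (c2 c hc0) (fun t a b => (hlt t a b).2.1)
  have k3 := hclose g3 i3 (c3 c hc0) (fun t a b => (hlt t a b).2.2.1)
  have kh := hclose h ih (ch c hc0) (fun t a b => (hlt t a b).2.2.2.le)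
  rcases kh.eq_or_lt with heq | hpos
  · refine ⟨c, hc0, heq.symm, ?_, fun t ht => (hlt t ht.1 ht.2).2.2.2⟩
    intro t ht
    rcases ht.2.eq_or_lt with he | hl
    · rw [he]; exact ⟨k1, k2, k3, kh⟩
    · obtain ⟨a, b, c', d⟩ := hlt t ht.1 hl
      exact ⟨a, b, c', d.le⟩
  · exfalso
    have ev : ∀ g : ℝ → ℝ, 0 ≤ g c → ContinuousAt g c → (g c = 0 → ∃ d, 0 < d ∧ HasDerivAt g d c) →
        ∀ᶠ s in nhdsWithin c (Ioi c), 0 < g s := by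
      intro g hg hgc hw
      rcases hg.eq_or_lt with h0 | h0
      · obtain ⟨d, hd, hd'⟩ := hw h0.symm
        exact pos_right hd h0.symm hd'
      · exact (hgc.eventually (lt_mem_nhds h0)).filter_mono nhdsWithin_le_nhds
    have e1 := ev g1 k1 (c1 c hc0) (w1 c hc0 k2 k3 hpos)
    have e2 := ev g2 k2 (c2 c hc0) (w2 c hc0 k1 k3 hpos)
    have e3 := ev g3 k3 (c3 c hc0) (w3 c hc0 k1 k2 hpos)
    have e4 := ev h kh (ch c hc0) (fun h0 => absurd h0 hpos.ne')
    have e5 := e1.and (e2.and (e3.and e4))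
    rw [Filter.Eventually, mem_nhdsGT_iff_exists_Ioo_subset] at e5
    obtain ⟨b, hb, hsub⟩ := e5
    obtain ⟨s, hsB, hsb⟩ := exists_lt_of_csInf_lt hne (show sInf B < b from hb)
    have hcs : c ≤ s := csInf_le hbdd hsB
    rcases hcs.eq_or_lt with h0 | h0
    · apply hsB.2; rw [← h0]; exact ⟨k1, k2, k3, hpos⟩
    · obtain ⟨a1, a2, a3, a4⟩ := hsub ⟨h0, hsb⟩
      exact hsB.2 ⟨a1.le, a2.le, a3.le, a4⟩

lemma stays_nonneg (f : ℝ → ℝ) (a b : ℝ) (hc : ContinuousOn f (Icc a b)) (h0 : 0 ≤ f a)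
    (hd : ∀ t ∈ Icc a b, f t < 0 → ∃ d, 0 ≤ d ∧ HasDerivAt f d t) :
    ∀ t ∈ Icc a b, 0 ≤ f t := by
  intro t ht
  by_contra hneg
  push Not at hneg
  set S := Icc a t ∩ f ⁻¹' (Ici 0) with hS
  have hSc : IsClosed S :=
    (hc.mono (Icc_subset_Icc_right ht.2)).preimage_isClosed_of_isClosed isClosed_Icc isClosed_Ici
  have hSn : S.Nonempty := ⟨a, ⟨le_rfl, ht.1⟩, h0⟩
  have hSb : BddAbove S := ⟨t, fun s hs => hs.1.2⟩
  have hcS := hSc.csSup_mem hSn hSb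
  set c := sSup S with hcdef
  have hcc : 0 ≤ f c := hcS.2
  have hbad : ∀ s, c < s → s ≤ t → f s < 0 := by
    intro s hs hst
    by_contra hn
    push Not at hn
    exact absurd (le_csSup hSb (show s ∈ S from ⟨⟨hcS.1.1.trans hs.le, hst⟩, hn⟩)) (not_le.2 hs)
  have hmono : MonotoneOn f (Icc c t) := by
    apply monotoneOn_of_deriv_nonneg (convex_Icc c t)
    · exact hc.mono (Icc_subset_Icc hcS.1.1 ht.2)
    · intro s hs
      rw [interior_Icc] at hs
      obtain ⟨d, _, hd'⟩ := hd s ⟨hcS.1.1.trans hs.1.le, hs.2.le.trans ht.2⟩ (hbad s hs.1 hs.2.le)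
      exact hd'.differentiableAt.differentiableWithinAt
    · intro s hs
      rw [interior_Icc] at hs
      obtain ⟨d, hd0, hd'⟩ := hd s ⟨hcS.1.1.trans hs.1.le, hs.2.le.trans ht.2⟩ (hbad s hs.1 hs.2.le)
      rw [hd'.deriv]; exact hd0
  have := hmono (left_mem_Icc.2 hcS.1.2) (right_mem_Icc.2 hcS.1.2) hcS.1.2
  linarith

/-! ### Part 5: the stages near the singular point -/

lemma left_poly (r : ℝ) (h0 : 0 < r) (h1 : r ≤ 27/100) :
    0 < 2 * (1 - r) * (3 * (r * (61/10 - 16 * r)) - (r * (61/10 - 16 * r)) ^ 3 - 8 * (1 - r) * r)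
      - 3 * (r * (61/10 - 16 * r)) ^ 2 * (61/10 - 32 * r) *
        ((1 - r) ^ 2 - (1 - r) / 2 + (r * (61/10 - 16 * r)) ^ 3) := by
  obtain ⟨s, rfl⟩ : ∃ s, r = 27/100 * s := ⟨r * (100/27), by ring⟩
  have hs : 0 < s := by linarith
  obtain ⟨q, hq⟩ : ∃ q, q = 1 - s := ⟨_, rfl⟩
  have hq0 : 0 ≤ q := by linarith
  have key : 0 <       (103/5)*(s^0*q^15) +
      (37982139/200000)*(s^1*q^14) +
      (128537517/160000)*(s^2*q^13) +
      (2159183397667/1000000000)*(s^3*q^12) +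
      (365647364311007397/100000000000000)*(s^4*q^11) +
      (1623899702641792011/500000000000000)*(s^5*q^10) +
      (427733688069534703/500000000000000)*(s^6*q^9) +
      (2515156230385109673/2500000000000000)*(s^7*q^8) +
      (7383379608564204753/1250000000000000)*(s^8*q^7) +
      (1590558664385338539479/156250000000000000)*(s^9*q^6) +
      (7049738784380377707627/781250000000000000)*(s^10*q^5) +
      (741704545615014127317/156250000000000000)*(s^11*q^4) +
      (474970701329259728813/312500000000000000)*(s^12*q^3) +
      (87900376426057270023/312500000000000000)*(s^13*q^2) +
      (7822970272819878387/312500000000000000)*(s^14*q^1) +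
      (762252834026819429/1562500000000000000)*(s^15*q^0) := by positivity
  have hmul := mul_pos h0 key
  rw [hq] at hmul
  refine lt_of_lt_of_eq hmul ?_
  ring

lemma Sol.contx {a t : ℝ} {x y : ℝ → ℝ} (h : Sol a x y) (ht : a ≤ t) : ContinuousAt x t :=
  (h t ht).1.continuousAt

lemma Sol.conty {a t : ℝ} {x y : ℝ → ℝ} (h : Sol a x y) (ht : a ≤ t) : ContinuousAt y t :=
  (h t ht).2.continuousAt

/-- the region left of the axis from which everything flows into `(0,1)` -/
def KL (x y : ℝ) : Prop :=
  x ≤ 0 ∧ 5329/10000 ≤ y ∧ y ≤ 1 ∧ 0 ≤ x + ((1 - √y) * (61/10 - 16 * (1 - √y))) ^ 3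

lemma KL_facts {x y : ℝ} (h0 : x ≤ 0) (h1 : 5329/10000 ≤ y) (h2 : y ≤ 1)
    (h3 : 0 ≤ x + ((1 - √y) * (61/10 - 16 * (1 - √y))) ^ 3) :
    73/100 ≤ √y ∧ √y ≤ 1 ∧ √y ^ 2 = y ∧ Bx x y := by
  have a1 : 73/100 ≤ √y := Real.le_sqrt_of_sq_le (by linarith)
  have a2 : √y ≤ 1 := Real.sqrt_le_one.2 h2
  have a3 : √y ^ 2 = y := Real.sq_sqrt (by linarith)
  refine ⟨a1, a2, a3, ?_, by linarith, by linarith, by linarith⟩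
  have b1 : (1 - √y) * (61/10 - 16 * (1 - √y)) ≤ 1 := by nlinarith [sq_nonneg (1 - √y - 61/320)]
  have b2 : ((1 - √y) * (61/10 - 16 * (1 - √y))) ^ 3 ≤ 1 ^ 3 := pow3_le.2 b1
  linarith

lemma KL_stage {x y : ℝ → ℝ} {t0 : ℝ} (hs : Sol t0 x y) (hK : KL (x t0) (y t0)) :
    ∃ t1, t0 ≤ t1 ∧ x t1 = 0 ∧ y t1 = 1 ∧ ∀ t ∈ Icc t0 t1, Bx (x t) (y t) := by
  obtain ⟨i1, i2, ih, i3⟩ := hK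
  have hder : ∀ t, t0 ≤ t → 0 < y t → HasDerivAt
      (fun t => x t + ((1 - √(y t)) * (61/10 - 16 * (1 - √(y t)))) ^ 3)
      (FX cc (x t) (y t) - 3 * ((1 - √(y t)) * (61/10 - 16 * (1 - √(y t)))) ^ 2 *
        (61/10 - 32 * (1 - √(y t))) * (FY (x t) (y t) / (2 * √(y t)))) t := by
    intro t ht hy0
    have h1 := (hs t ht).1
    have h2 := (hs t ht).2.sqrt hy0.ne'
    have h3 : HasDerivAt (fun t => 1 - √(y t)) _ t := h2.const_sub 1
    have h4 : HasDerivAt (fun t => (61/10 : ℝ) - 16 * (1 - √(y t))) _ t := (h3.const_mul 16).const_sub (61/10)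
    have h5 : HasDerivAt (fun t => (1 - √(y t)) * (61/10 - 16 * (1 - √(y t)))) _ t := h3.mul h4
    have h6 : HasDerivAt (fun t => ((1 - √(y t)) * (61/10 - 16 * (1 - √(y t)))) ^ 3) _ t := h5.pow 3
    refine (h1.add h6).congr_deriv ?_
    push_cast
    ring
  obtain ⟨t1, ht1, he, hin, _⟩ := stage (fun t => - x t) (fun t => y t - 5329/10000)
    (fun t => x t + ((1 - √(y t)) * (61/10 - 16 * (1 - √(y t)))) ^ 3) (fun t => 1 - y t) y t0 (1/10) 1
    (by norm_num) (by linarith) (by linarith) i3 (by linarith)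
    (fun t ht => (hs.contx ht).neg) (fun t ht => (hs.conty ht).sub continuousAt_const)
    (fun t ht => by
      have h1 := hs.contx ht
      have h2 := (hs.conty ht).sqrt
      exact h1.add (((continuousAt_const.sub h2).mul (continuousAt_const.sub
        (continuousAt_const.mul (continuousAt_const.sub h2)))).pow 3))
    (fun t ht => continuousAt_const.sub (hs.conty ht))
    (by
      intro t ht g2 g3 gh g1
      obtain ⟨a1, a2, a3, a4⟩ := KL_facts (by linarith) (by linarith) (by linarith) g3
      refine ⟨_, ?_, (hs t ht).1.neg⟩
      rw [FX_eq a4, show x t = 0 by linarith, cbrt_zero]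
      have : √(y t) < 1 := by nlinarith
      nlinarith)
    (by
      intro t ht g1 g3 gh g2
      obtain ⟨a1, a2, a3, a4⟩ := KL_facts (by linarith) (by linarith) (by linarith) g3
      refine ⟨_, ?_, (hs t ht).2.sub_const _⟩
      rw [FY_eq a4]
      nlinarith)
    (by
      intro t ht g1 g2 gh g3
      obtain ⟨a1, a2, a3, a4⟩ := KL_facts (by linarith) (by linarith) (by linarith) g3.ge
      refine ⟨_, ?_, hder t ht (by linarith)⟩
      rw [FX_eq a4, FY_eq a4]
      have hv : √(y t) < 1 := by nlinarith
      have hp := left_poly (1 - √(y t)) (by linarith) (by linarith)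
      generalize √(y t) = v at *
      obtain ⟨r, rfl⟩ : ∃ r, v = 1 - r := ⟨1 - v, by ring⟩
      rw [show 1 - (1 - r) = r by ring] at *
      set P := r * (61/10 - 16 * r) with hP
      have hx : x t = (-P) ^ 3 := by rw [Odd.neg_pow (by decide)]; linarith
      have hu : cbrt (x t) = -P := by rw [hx, cbrt_cube]
      rw [hu, ← a3, hx]
      have hv2 : 0 < 2 * (1 - r) := by linarith
      have e : -3 * -P + (-P) ^ 3 + 8 * ((1 - r) ^ 2 - (1 - r)) -
          3 * P ^ 2 * (61/10 - 32 * r) * (((1 - r) ^ 2 - (1 - r) / 2 - (-P) ^ 3) / (2 * (1 - r))) =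
          (2 * (1 - r) * (3 * P - P ^ 3 - 8 * (1 - r) * r)
      - 3 * P ^ 2 * (61/10 - 32 * r) * ((1 - r) ^ 2 - (1 - r) / 2 + P ^ 3)) / (2 * (1 - r)) := by
        have h1r : 1 - r ≠ 0 := by linarith
        field_simp
        ring
      rw [e]
      exact div_pos hp hv2)
    (by
      intro t ht g1 g2 g3 gh
      obtain ⟨a1, a2, a3, a4⟩ := KL_facts (by linarith) (by linarith) (by linarith) g3
      refine ⟨by linarith, _, ?_, (hs t ht).2⟩
      rw [FY_eq a4]
      nlinarith)
  have hy1 : y t1 = 1 := by linarith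
  refine ⟨t1, ht1, ?_, hy1, ?_⟩
  · obtain ⟨b1, b2, b3, b4⟩ := hin t1 (right_mem_Icc.2 ht1)
    rw [hy1] at b3
    norm_num at b3
    linarith
  · intro t ht
    obtain ⟨b1, b2, b3, b4⟩ := hin t ht
    exact (KL_facts (by linarith) (by linarith) (by linarith) b3).2.2.2

lemma O_stage {x y : ℝ → ℝ} {t0 : ℝ} (hs : Sol t0 x y) (hx0 : x t0 = 0) (hy0 : y t0 = 1) :
    ∃ t1, t0 < t1 ∧ √(y t1) = 109/100 ∧ 1/5 ≤ cbrt (x t1) ∧ cbrt (x t1) ≤ 2508/10000 ∧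
      ∀ t ∈ Icc t0 t1, Bx (x t) (y t) := by
  have facts : ∀ t, 0 ≤ y t - 1 → 0 ≤ x t + 1/10 → 0 ≤ (y t - 1) / 8 - x t → 0 ≤ 11881/10000 - y t →
      1 ≤ √(y t) ∧ √(y t) ≤ 109/100 ∧ √(y t) ^ 2 = y t ∧ Bx (x t) (y t) := by
    intro t h1 h2 h3 h4
    refine ⟨Real.one_le_sqrt.2 (by linarith), ?_, Real.sq_sqrt (by linarith), by linarith, by linarith,
      by linarith, by linarith⟩
    rw [Real.sqrt_le_left (by norm_num)]; linarith
  obtain ⟨t1, ht1, he, hin, _⟩ := stage (fun t => y t - 1) (fun t => x t + 1/10)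
    (fun t => (y t - 1) / 8 - x t) (fun t => 11881/10000 - y t) y t0 (1/10) 2
    (by norm_num) (by simp [hy0]) (by simp only [hx0]; norm_num) (by simp [hx0, hy0]) (by simp only [hy0]; norm_num)
    (fun t ht => (hs.conty ht).sub continuousAt_const)
    (fun t ht => (hs.contx ht).add continuousAt_const)
    (fun t ht => (((hs.conty ht).sub continuousAt_const).div_const 8).sub (hs.contx ht))
    (fun t ht => continuousAt_const.sub (hs.conty ht))
    (by
      intro t ht g2 g3 gh g1
      obtain ⟨a1, a2, a3, a4⟩ := facts t g1.ge g2 g3 gh.le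
      refine ⟨_, ?_, (hs t ht).2.sub_const _⟩
      rw [FY_eq a4]
      have : √(y t) ≤ y t := by nlinarith
      linarith)
    (by
      intro t ht g1 g3 gh g2
      obtain ⟨a1, a2, a3, a4⟩ := facts t g1 g2.ge g3 gh.le
      refine ⟨_, ?_, (hs t ht).1.add_const _⟩
      rw [FX_eq a4]
      have hu : cbrt (x t) ≤ -4/10 := by rw [cbrt_le_iff]; norm_num; linarith
      nlinarith)
    (by
      intro t ht g1 g2 gh g3
      obtain ⟨a1, a2, a3, a4⟩ := facts t g1 g2 g3.ge gh.le
      refine ⟨_, ?_, (((hs t ht).2.sub_const _).div_const 8).sub (hs t ht).1⟩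
      rw [FX_eq a4, FY_eq a4]
      obtain ⟨q, hq⟩ : ∃ q, √(y t) = 1 + q := ⟨√(y t) - 1, by ring⟩
      rw [hq] at a1 a2 a3 ⊢
      have hq0 : 0 ≤ q := by linarith
      have hq1 : q ≤ 9/100 := by linarith
      have hx : x t = q * (2 + q) / 8 := by linarith
      have hu : 31/10 * q ≤ cbrt (x t) := by
        rw [le_cbrt_iff, hx]
        have : q ^ 2 ≤ (9/100) ^ 2 := by gcongr
        nlinarith
      rw [← a3]
      rw [← a3] at g3
      nlinarith)
    (by
      intro t ht g1 g2 g3 gh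
      obtain ⟨a1, a2, a3, a4⟩ := facts t g1 g2 g3 gh.le
      refine ⟨by linarith, _, ?_, (hs t ht).2⟩
      rw [FY_eq a4]
      nlinarith)
  have hlow := stays_nonneg (fun t => x t - (213/200 * (y t - 1)) ^ 3) t0 t1
    (fun t ht => ((hs.contx ht.1).sub ((continuousAt_const.mul ((hs.conty ht.1).sub continuousAt_const)).pow 3)).continuousWithinAt)
    (by simp [hx0, hy0])
    (by
      intro t ht hneg
      obtain ⟨b1, b2, b3, b4⟩ := hin t ht
      obtain ⟨a1, a2, a3, a4⟩ := facts t b1 b2 b3 b4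
      have hd : HasDerivAt (fun t => (213/200 * (y t - 1)) ^ 3) _ t :=
        (((hs t ht.1).2.sub_const 1).const_mul (213/200)).pow 3
      refine ⟨_, ?_, (hs t ht.1).1.sub hd⟩
      rw [FX_eq a4, FY_eq a4]
      have hu : cbrt (x t) ≤ 213/200 * (y t - 1) := by rw [cbrt_le_iff]; linarith
      push_cast
      have hx3 := cbrt_pow3 (x t)
      have hul : -1 ≤ cbrt (x t) := by rw [le_cbrt_iff]; linarith
      set u := cbrt (x t)
      set w := y t - 1 with hw
      have hw0 : 0 ≤ w := b1
      have hw1 : w ≤ 1881/10000 := by linarith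
      have k1 : -3 * (213/200 * w) ≤ -3 * u + u ^ 3 := by
        rcases le_total 0 u with h | h
        · have := pow_nonneg h 3
          linarith
        · have h1 : u ^ 2 ≤ 1 := by nlinarith
          have h2 : 0 ≤ u * (u ^ 2 - 3) := mul_nonneg_of_nonpos_of_nonpos h (by linarith)
          nlinarith
      have k2 : 4 * w ≤ 8 * (y t - √(y t)) := by
        have : w = √(y t) ^ 2 - 1 := by linarith
        nlinarith
      have k3 : y t - √(y t) / 2 - x t ≤ 8/10 := by linarith
      have k4 : 3 * (213/200 * w) ^ 2 * (213/200 * (y t - √(y t) / 2 - x t)) ≤ 3 * (213/200 * w) ^ 2 * (213/200 * (8/10)) := by gcongr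
      norm_num at k4 ⊢
      nlinarith)
  have hup := stays_nonneg (fun t => (4/3 * (y t - 1)) ^ 3 - x t) t0 t1
    (fun t ht => (((continuousAt_const.mul ((hs.conty ht.1).sub continuousAt_const)).pow 3).sub (hs.contx ht.1)).continuousWithinAt)
    (by simp [hx0, hy0])
    (by
      intro t ht hneg
      obtain ⟨b1, b2, b3, b4⟩ := hin t ht
      obtain ⟨a1, a2, a3, a4⟩ := facts t b1 b2 b3 b4
      have hd : HasDerivAt (fun t => (4/3 * (y t - 1)) ^ 3) _ t :=
        (((hs t ht.1).2.sub_const 1).const_mul (4/3)).pow 3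
      refine ⟨_, ?_, hd.sub (hs t ht.1).1⟩
      rw [FX_eq a4, FY_eq a4]
      have hu : 4/3 * (y t - 1) ≤ cbrt (x t) := by rw [le_cbrt_iff]; linarith
      push_cast
      have hx3 := cbrt_pow3 (x t)
      have hul : cbrt (x t) ≤ 4/10 := by rw [cbrt_le_iff]; norm_num; linarith
      set u := cbrt (x t)
      set w := y t - 1 with hw
      have hw0 : 0 ≤ w := b1
      have hw1 : w ≤ 1881/10000 := by linarith
      have k0 : 0 ≤ 4/3 * w := by positivity
      have k1 : -3 * u + u ^ 3 ≤ -3 * (4/3 * w) + (4/3 * w) ^ 3 := by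
        nlinarith [mul_nonneg (sub_nonneg.2 hu) k0, mul_nonneg (sub_nonneg.2 hu) (k0.trans hu),
          mul_nonneg (sub_nonneg.2 hu) (sub_nonneg.2 hul), mul_nonneg (mul_nonneg (sub_nonneg.2 hu) k0) (sub_nonneg.2 hul),
          mul_nonneg (mul_nonneg (sub_nonneg.2 hu) (k0.trans hu)) (sub_nonneg.2 hul),
          mul_nonneg (mul_nonneg (sub_nonneg.2 hu) k0) (sub_nonneg.2 (hu.trans hul))]
      have k2 : 8 * (y t - √(y t)) ≤ 4 * w + 2 * w ^ 2 := by
        obtain ⟨q, hq⟩ : ∃ q, √(y t) = 1 + q := ⟨√(y t) - 1, by ring⟩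
        have hq0 : 0 ≤ q := by linarith
        have : w = q * (2 + q) := by rw [hw, ← a3, hq]; ring
        rw [hq] at *
        rw [← a3, this]
        nlinarith [mul_nonneg hq0 hq0, mul_nonneg (mul_nonneg hq0 hq0) hq0]
      have k3 : 4/10 ≤ y t - √(y t) / 2 - x t := by nlinarith
      have k4 : 3 * (4/3 * w) ^ 2 * (4/3 * (4/10)) ≤ 3 * (4/3 * w) ^ 2 * (4/3 * (y t - √(y t) / 2 - x t)) := by gcongr
      norm_num at k4 ⊢
      nlinarith [mul_nonneg hw0 hw0])
  have hy1 : y t1 = 11881/10000 := by linarith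
  have hl := hlow t1 (right_mem_Icc.2 ht1)
  have hu := hup t1 (right_mem_Icc.2 ht1)
  simp only [hy1] at hl hu
  refine ⟨t1, lt_of_le_of_ne ht1 ?_, ?_, ?_, ?_, ?_⟩
  · rintro rfl; rw [hy0] at hy1; norm_num at hy1
  · rw [hy1, show (11881/10000 : ℝ) = (109/100) ^ 2 by norm_num, Real.sqrt_sq (by norm_num)]
  · rw [le_cbrt_iff]; norm_num at hl ⊢; linarith
  · rw [cbrt_le_iff]; norm_num at hu ⊢; linarith
  · intro t ht
    obtain ⟨b1, b2, b3, b4⟩ := hin t ht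
    exact (facts t b1 b2 b3 b4).2.2.2

lemma final_stage {x y : ℝ → ℝ} {t0 : ℝ} (hs : Sol t0 x y) (hx0 : cbrt (x t0) = 5/100)
    (h1 : 733/1000 ≤ √(y t0)) (h2 : √(y t0) ≤ 937/1000) :
    ∃ t1, t0 ≤ t1 ∧ x t1 = 0 ∧ 537/1000 ≤ y t1 ∧ y t1 ≤ 88/100 ∧ ∀ t ∈ Icc t0 t1, Bx (x t) (y t) := by
  have hx : x t0 = 1/8000 := by have := cbrt_pow3 (x t0); rw [hx0] at this; rw [← this]; norm_num
  have hypos : 0 ≤ y t0 := by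
    by_contra hc
    rw [Real.sqrt_eq_zero_of_nonpos (by linarith)] at h1; norm_num at h1
  have hsq := Real.sq_sqrt hypos
  have facts : ∀ t, 0 ≤ y t - 537289/1000000 → 0 ≤ 8785/10000 - y t - 2 * x t → 0 ≤ 1/5000 - x t → 0 ≤ x t →
      733/1000 ≤ √(y t) ∧ √(y t) ≤ 938/1000 ∧ √(y t) ^ 2 = y t ∧ Bx (x t) (y t) ∧ 0 ≤ cbrt (x t) := by
    intro t h1 h2 h3 h4
    refine ⟨Real.le_sqrt_of_sq_le (by linarith), ?_, Real.sq_sqrt (by linarith), ⟨by linarith, by linarith,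
      by linarith, by linarith⟩, ?_⟩
    · rw [Real.sqrt_le_left (by norm_num)]; linarith
    · have := cbrt_mono h4; rwa [cbrt_zero] at this
  obtain ⟨t1, ht1, he, hin, _⟩ := stage (fun t => y t - 537289/1000000) (fun t => 8785/10000 - y t - 2 * x t)
    (fun t => 1/5000 - x t) (fun t => x t) (fun t => - x t) t0 (1/10) 1
    (by norm_num) (by nlinarith) (by nlinarith) (by linarith) (by linarith)
    (fun t ht => (hs.conty ht).sub continuousAt_const)
    (fun t ht => (continuousAt_const.sub (hs.conty ht)).sub (continuousAt_const.mul (hs.contx ht)))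
    (fun t ht => continuousAt_const.sub (hs.contx ht))
    (fun t ht => hs.contx ht)
    (by
      intro t ht g2 g3 gh g1
      obtain ⟨a1, a2, a3, a4, a5⟩ := facts t g1.ge g2 g3 gh.le
      refine ⟨_, ?_, (hs t ht).2.sub_const _⟩
      rw [FY_eq a4]
      nlinarith)
    (by
      intro t ht g1 g3 gh g2
      obtain ⟨a1, a2, a3, a4, a5⟩ := facts t g1 g2.ge g3 gh.le
      refine ⟨_, ?_, ((hs t ht).2.const_sub _).sub ((hs t ht).1.const_mul 2)⟩
      rw [FX_eq a4, FY_eq a4]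
      have : √(y t) ≥ 93/100 := Real.le_sqrt_of_sq_le (by linarith)
      nlinarith)
    (by
      intro t ht g1 g2 gh g3
      obtain ⟨a1, a2, a3, a4, a5⟩ := facts t g1 g2 g3.ge gh.le
      refine ⟨_, ?_, (hs t ht).1.const_sub _⟩
      rw [FX_eq a4]
      nlinarith)
    (by
      intro t ht g1 g2 g3 gh
      obtain ⟨a1, a2, a3, a4, a5⟩ := facts t g1 g2 g3 gh.le
      refine ⟨by linarith, _, ?_, (hs t ht).1.neg⟩
      rw [FX_eq a4]
      nlinarith)
  obtain ⟨b1, b2, b3, b4⟩ := hin t1 (right_mem_Icc.2 ht1)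
  refine ⟨t1, ht1, he, by linarith, by linarith, ?_⟩
  intro t ht
  obtain ⟨b1, b2, b3, b4⟩ := hin t ht
  exact (facts t b1 b2 b3 b4).2.2.2.1

/-! ### Part 6: the quadrilateral chain, in the coordinates `a = N·x^{1/3}`, `b = N·√y` -/

/-- coefficients of the first component along a segment -/
def sA0 (a b : ℤ) : ℤ := -3*a*100000^2 + a^3 + 8*(b^2*100000 - b*100000^2)
/-- coefficients of the first component along a segment -/
def sA1 (a b c e : ℤ) : ℤ := -3*c*100000^2 + 3*a^2*c + 8*(2*b*e*100000 - e*100000^2)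
/-- coefficients of the first component along a segment -/
def sA2 (a c e : ℤ) : ℤ := 3*a*c^2 + 8*e^2*100000
/-- coefficients of the second component along a segment -/
def sB0 (a b : ℤ) : ℤ := 2*b^2*100000 - b*100000^2 - 2*a^3
/-- coefficients of the second component along a segment -/
def sB1 (a b c e : ℤ) : ℤ := 4*b*e*100000 - e*100000^2 - 6*a^2*c
/-- coefficients of the second component along a segment -/
def sB2 (a c e : ℤ) : ℤ := 2*e^2*100000 - 6*a*c^2

/-- coefficients of the crossing polynomial along a segment -/
def sg0 (a b c e : ℤ) : ℤ := -4*e*100000*(b*sA0 a b) + 3*c*(a^2*sB0 a b)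
/-- coefficients of the crossing polynomial along a segment -/
def sg1 (a b c e : ℤ) : ℤ := -4*e*100000*(b*sA1 a b c e + e*sA0 a b) + 3*c*(a^2*sB1 a b c e + 2*a*c*sB0 a b)
/-- coefficients of the crossing polynomial along a segment -/
def sg2 (a b c e : ℤ) : ℤ :=
  -4*e*100000*(b*sA2 a c e + e*sA1 a b c e) + 3*c*(a^2*sB2 a c e + 2*a*c*sB1 a b c e + c^2*sB0 a b)
/-- coefficients of the crossing polynomial along a segment -/
def sg3 (a b c e : ℤ) : ℤ :=
  -4*e*100000*(b*c^3 + e*sA2 a c e) + 3*c*(a^2*(-2*c^3) + 2*a*c*sB2 a c e + c^2*sB1 a b c e)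
/-- coefficients of the crossing polynomial along a segment -/
def sg4 (a c e : ℤ) : ℤ := -4*e*100000*(e*c^3) + 3*c*(2*a*c*(-2*c^3) + c^2*sB2 a c e)
/-- coefficients of the crossing polynomial along a segment -/
def sg5 (c : ℤ) : ℤ := 3*c*(c^2*(-2*c^3))

/-- test that the field crosses a segment in the direction given by the sign `σ` -/
def segT (σ a b c e : ℤ) : Bool :=
  let S := |sg2 a b c e| + |sg3 a b c e| + |sg4 a c e| + |sg5 c|
  decide (0 < σ * sg0 a b c e - S) && decide (0 < σ * sg0 a b c e + σ * sg1 a b c e - S)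

/-- scaled first component of the field -/
def hA (a b : ℝ) : ℝ := -3*a*100000^2 + a^3 + 8*(b^2*100000 - b*100000^2)
/-- scaled second component of the field -/
def hB (a b : ℝ) : ℝ := 2*b^2*100000 - b*100000^2 - 2*a^3
/-- crossing speed (up to a positive factor) through a line with direction `(c,e)` -/
def hG (c e a b : ℝ) : ℝ := c * (3*a^2*hB a b) - e * (4*100000*b*hA a b)

lemma segT_poly (a b c e : ℤ) (s : ℝ) : hG c e (a + c*s) (b + e*s) =
    sg0 a b c e + sg1 a b c e * s + sg2 a b c e * s^2 + sg3 a b c e * s^3 + sg4 a c e * s^4 + sg5 c * s^5 := by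
  simp only [hG, hA, hB, sg0, sg1, sg2, sg3, sg4, sg5, sA0, sA1, sA2, sB0, sB1, sB2]
  push_cast
  ring

lemma segT_sound {σ a b c e : ℤ} (h : segT σ a b c e = true) (hσ : σ = 1 ∨ σ = -1) (s : ℝ)
    (h0 : 0 ≤ s) (h1 : s ≤ 1) : 0 < σ * hG c e (a + c*s) (b + e*s) := by
  simp only [segT, Bool.and_eq_true, decide_eq_true_eq] at h
  obtain ⟨k1, k2⟩ := h
  have k1' := (Int.cast_lt (R := ℝ)).2 k1
  have k2' := (Int.cast_lt (R := ℝ)).2 k2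
  push_cast at k1' k2'
  rw [segT_poly]
  generalize (sg0 a b c e : ℝ) = g0 at *
  generalize (sg1 a b c e : ℝ) = g1 at *
  generalize (sg2 a b c e : ℝ) = g2 at *
  generalize (sg3 a b c e : ℝ) = g3 at *
  generalize (sg4 a c e : ℝ) = g4 at *
  generalize (sg5 c : ℝ) = g5 at *
  have hab : |(σ:ℝ)| = 1 := by rcases hσ with rfl | rfl <;> norm_num
  have key : ∀ (g : ℝ) (n : ℕ), - |g| ≤ σ * (g * s ^ n) := by
    intro g n
    have h2 : |σ * (g * s ^ n)| ≤ |g| := by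
      rw [abs_mul, hab, one_mul, abs_mul, abs_of_nonneg (pow_nonneg h0 n)]
      exact mul_le_of_le_one_right (abs_nonneg _) (pow_le_one₀ h0 h1)
    exact (abs_le.1 h2).1
  have e2 := key g2 2
  have e3 := key g3 3
  have e4 := key g4 4
  have e5 := key g5 5
  have e1 : |g2| + |g3| + |g4| + |g5| < σ * g0 + σ * g1 * s := by
    generalize (σ:ℝ) * g1 = G at *
    rcases le_total 0 G with h | h
    · have := mul_nonneg h h0
      linarith
    · have := mul_nonneg_of_nonpos_of_nonpos h (sub_nonpos.2 h1)
      nlinarith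
  have : σ * (g0 + g1 * s + g2 * s ^ 2 + g3 * s ^ 3 + g4 * s ^ 4 + g5 * s ^ 5) =
    (σ * g0 + σ * g1 * s) + σ * (g2 * s ^ 2) + σ * (g3 * s ^ 3) + σ * (g4 * s ^ 4) + σ * (g5 * s ^ 5) := by ring
  rw [this]
  linarith

/-- orientation function of the directed line from `(v1,v2)` to `(w1,w2)` -/
def cr (v1 v2 w1 w2 a b : ℝ) : ℝ := (v1 - a) * (w2 - b) - (w1 - a) * (v2 - b)
/-- integer version of `cr` -/
def crZ (v1 v2 w1 w2 a b : ℤ) : ℤ := (v1 - a) * (w2 - b) - (w1 - a) * (v2 - b)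

lemma cr_cast (v1 v2 w1 w2 a b : ℤ) : cr v1 v2 w1 w2 a b = (crZ v1 v2 w1 w2 a b : ℝ) := by
  simp only [cr, crZ]; push_cast; ring

lemma cr_wall {x1 x2 v1 v2 w1 w2 y1 y2 a b : ℝ} (h0 : cr v1 v2 w1 w2 a b = 0)
    (h1 : 0 ≤ cr x1 x2 v1 v2 a b) (h2 : 0 ≤ cr w1 w2 y1 y2 a b)
    (k1 : 0 < cr x1 x2 v1 v2 w1 w2) (k2 : 0 < cr w1 w2 y1 y2 v1 v2) :
    ∃ s, 0 ≤ s ∧ s ≤ 1 ∧ a = v1 + (w1 - v1) * s ∧ b = v2 + (w2 - v2) * s := by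
  set D := cr x1 x2 v1 v2 w1 w2 with hD
  have ea : a = v1 + (w1 - v1) * (cr x1 x2 v1 v2 a b / D) := by
    have h3 : (a - v1) * D = (w1 - v1) * cr x1 x2 v1 v2 a b := by
      rw [hD]
      simp only [cr] at h0 ⊢
      linear_combination (x1 - v1) * h0
    rw [mul_div_assoc', ← h3, mul_div_assoc, div_self k1.ne']
    ring
  have eb : b = v2 + (w2 - v2) * (cr x1 x2 v1 v2 a b / D) := by
    have h3 : (b - v2) * D = (w2 - v2) * cr x1 x2 v1 v2 a b := by
      rw [hD]
      simp only [cr] at h0 ⊢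
      linear_combination (x2 - v2) * h0
    rw [mul_div_assoc', ← h3, mul_div_assoc, div_self k1.ne']
    ring
  refine ⟨cr x1 x2 v1 v2 a b / D, div_nonneg h1 k1.le, ?_, ea, eb⟩
  generalize cr x1 x2 v1 v2 a b / D = s at *
  have : cr w1 w2 y1 y2 a b = (1 - s) * cr w1 w2 y1 y2 v1 v2 := by
    rw [ea, eb]; simp only [cr]; ring
  rw [this] at h2
  by_contra hc
  push Not at hc
  nlinarith

lemma cr_tri {x1 y1 x2 y2 x3 y3 a b l1 l2 m1 m2 : ℝ} (h1 : 0 ≤ cr x1 y1 x2 y2 a b)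
    (h2 : 0 ≤ cr x2 y2 x3 y3 a b) (h3 : 0 ≤ cr x3 y3 x1 y1 a b) (hS : 0 < cr x1 y1 x2 y2 x3 y3)
    (b1 : l1 ≤ x1 ∧ x1 ≤ l2) (b2 : l1 ≤ x2 ∧ x2 ≤ l2) (b3 : l1 ≤ x3 ∧ x3 ≤ l2)
    (c1 : m1 ≤ y1 ∧ y1 ≤ m2) (c2 : m1 ≤ y2 ∧ y2 ≤ m2) (c3 : m1 ≤ y3 ∧ y3 ≤ m2) :
    l1 ≤ a ∧ a ≤ l2 ∧ m1 ≤ b ∧ b ≤ m2 := by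
  have hs : cr x1 y1 x2 y2 x3 y3 = cr x1 y1 x2 y2 a b + cr x2 y2 x3 y3 a b + cr x3 y3 x1 y1 a b := by
    simp only [cr]; ring
  have ha : cr x1 y1 x2 y2 x3 y3 * a = cr x1 y1 x2 y2 a b * x3 + cr x2 y2 x3 y3 a b * x1 + cr x3 y3 x1 y1 a b * x2 := by
    simp only [cr]; ring
  have hb : cr x1 y1 x2 y2 x3 y3 * b = cr x1 y1 x2 y2 a b * y3 + cr x2 y2 x3 y3 a b * y1 + cr x3 y3 x1 y1 a b * y2 := by
    simp only [cr]; ring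
  generalize cr x1 y1 x2 y2 x3 y3 = S at *
  generalize cr x1 y1 x2 y2 a b = p at *
  generalize cr x2 y2 x3 y3 a b = q at *
  generalize cr x3 y3 x1 y1 a b = r at *
  refine ⟨?_, ?_, ?_, ?_⟩ <;> refine le_of_mul_le_mul_left ?_ hS
  · rw [ha, hs]
    linarith [mul_le_mul_of_nonneg_left b3.1 h1, mul_le_mul_of_nonneg_left b1.1 h2, mul_le_mul_of_nonneg_left b2.1 h3]
  · rw [ha, hs]
    linarith [mul_le_mul_of_nonneg_left b3.2 h1, mul_le_mul_of_nonneg_left b1.2 h2, mul_le_mul_of_nonneg_left b2.2 h3]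
  · rw [hb, hs]
    linarith [mul_le_mul_of_nonneg_left c3.1 h1, mul_le_mul_of_nonneg_left c1.1 h2, mul_le_mul_of_nonneg_left c2.1 h3]
  · rw [hb, hs]
    linarith [mul_le_mul_of_nonneg_left c3.2 h1, mul_le_mul_of_nonneg_left c1.2 h2, mul_le_mul_of_nonneg_left c2.2 h3]

lemma lin2 {c x l u k : ℝ} (h1 : l ≤ x) (h2 : x ≤ u) (k1 : k ≤ c * l) (k2 : k ≤ c * u) : k ≤ c * x := by
  rcases le_total 0 c with h | h <;> nlinarith

lemma bil {E v X l u m M k : ℝ} (h1 : l ≤ v) (h2 : v ≤ u) (h3 : m ≤ X) (h4 : X ≤ M)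
    (k1 : k ≤ E * (l * m)) (k2 : k ≤ E * (l * M)) (k3 : k ≤ E * (u * m)) (k4 : k ≤ E * (u * M)) :
    k ≤ E * (v * X) := by
  have a1 : k ≤ (E * l) * X := lin2 h3 h4 (by linarith) (by linarith)
  have a2 : k ≤ (E * u) * X := lin2 h3 h4 (by linarith) (by linarith)
  have := lin2 (c := E * X) h1 h2 (k := k) (by linarith) (by linarith)
  linarith

/-- minimum of `E v X` over the corners of a box -/
def min4 (E l u m M : ℤ) : ℤ := min (min (E * (l * m)) (E * (l * M))) (min (E * (u * m)) (E * (u * M)))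

lemma min4_le {E l u m M : ℤ} {v X : ℝ} (h1 : l ≤ v) (h2 : v ≤ u) (h3 : m ≤ X) (h4 : X ≤ M) :
    (min4 E l u m M : ℝ) ≤ E * (v * X) := by
  have e1 : min4 E l u m M ≤ E * (l * m) := (min_le_left _ _).trans (min_le_left _ _)
  have e2 : min4 E l u m M ≤ E * (l * M) := (min_le_left _ _).trans (min_le_right _ _)
  have e3 : min4 E l u m M ≤ E * (u * m) := (min_le_right _ _).trans (min_le_left _ _)
  have e4 : min4 E l u m M ≤ E * (u * M) := (min_le_right _ _).trans (min_le_right _ _)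
  exact bil h1 h2 h3 h4 (by exact_mod_cast e1) (by exact_mod_cast e2) (by exact_mod_cast e3) (by exact_mod_cast e4)

/-- test that the field has progress across the box in the direction normal to `(c,e)` -/
def progT (c e u0 u1 v0 v1 : ℤ) : Bool :=
  decide (0 < min4 (c * 3) (u0^2) (u1^2) (2*v0^2*100000 - v0*100000^2 - 2*u1^3) (2*v1^2*100000 - v1*100000^2 - 2*u0^3)
    + min4 (-e * 400000) v0 v1 (-3*u1*100000^2 + u0^3 + 8*(v0^2*100000 - v0*100000^2))
      (-3*u0*100000^2 + u1^3 + 8*(v1^2*100000 - v1*100000^2)))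

lemma progT_sound {c e u0 u1 v0 v1 : ℤ} (h : progT c e u0 u1 v0 v1 = true) (hu : 0 < u0) (hv : 70000 ≤ v0)
    {a b : ℝ} (h1 : u0 ≤ a) (h2 : a ≤ u1) (h3 : v0 ≤ b) (h4 : b ≤ v1) : 1 ≤ hG c e a b := by
  simp only [progT, decide_eq_true_eq] at h
  have hu' : (0:ℝ) < u0 := by exact_mod_cast hu
  have hv' : (70000:ℝ) ≤ v0 := by exact_mod_cast hv
  have p1 : (u0:ℝ)^2 ≤ a^2 := by gcongr
  have p2 : a^2 ≤ (u1:ℝ)^2 := by have : 0 ≤ a := by linarith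
                                 gcongr
  have p3 : (u0:ℝ)^3 ≤ a^3 := pow3_le.2 h1
  have p4 : a^3 ≤ (u1:ℝ)^3 := pow3_le.2 h2
  have q1 : (v0:ℝ)^2 * 100000 - v0*100000^2 ≤ b^2*100000 - b*100000^2 := by nlinarith
  have q2 : b^2*100000 - b*100000^2 ≤ (v1:ℝ)^2 * 100000 - v1*100000^2 := by nlinarith
  have q3 : 2*(v0:ℝ)^2 * 100000 - v0*100000^2 ≤ 2*b^2*100000 - b*100000^2 := by nlinarith
  have q4 : 2*b^2*100000 - b*100000^2 ≤ 2*(v1:ℝ)^2 * 100000 - v1*100000^2 := by nlinarith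
  have m1 := min4_le (E := c * 3) (l := u0^2) (u := u1^2) (m := 2*v0^2*100000 - v0*100000^2 - 2*u1^3)
    (M := 2*v1^2*100000 - v1*100000^2 - 2*u0^3) (v := a^2) (X := hB a b)
    (by push_cast; exact p1) (by push_cast; exact p2) (by push_cast; unfold hB; linarith)
    (by push_cast; unfold hB; linarith)
  have m2 := min4_le (E := -e * 400000) (l := v0) (u := v1) (m := -3*u1*100000^2 + u0^3 + 8*(v0^2*100000 - v0*100000^2))
    (M := -3*u0*100000^2 + u1^3 + 8*(v1^2*100000 - v1*100000^2)) (v := b) (X := hA a b)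
    h3 h4 (by push_cast; unfold hA; linarith) (by push_cast; unfold hA; linarith)
  have h' : (1:ℤ) ≤ _ := h
  have h'' := (Int.cast_le (R := ℝ)).2 h'
  rw [Int.cast_add] at h''
  have : hG c e a b = (c * 3 : ℤ) * (a^2 * hB a b) + (-e * 400000 : ℤ) * (b * hA a b) := by
    unfold hG; push_cast; ring
  rw [this]
  push_cast at h'' m1 m2 ⊢
  linarith

/-! ### Part 7: one quadrilateral, and the chain -/

lemma cr_deriv {x y : ℝ → ℝ} {t0 t : ℝ} (hs : Sol t0 x y) (ht : t0 ≤ t) (hx : 0 < x t) (hB : Bx (x t) (y t))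
    (v1 v2 w1 w2 : ℝ) :
    HasDerivAt (fun t => cr v1 v2 w1 w2 (100000 * cbrt (x t)) (100000 * √(y t)))
      (hG (w1 - v1) (w2 - v2) (100000 * cbrt (x t)) (100000 * √(y t)) /
        (12 * (100000 * cbrt (x t)) ^ 2 * (100000 * √(y t)) * 100000)) t := by
  have hy : 0 < y t := by linarith [hB.2.2.1]
  have h1 : HasDerivAt (fun t => cbrt (x t)) _ t := (cbrt_hasDerivAt hx.ne').comp t (hs t ht).1
  have h2 : HasDerivAt (fun t => √(y t)) _ t := (hs t ht).2.sqrt hy.ne'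
  have h1' := h1.const_mul 100000
  have h2' := h2.const_mul 100000
  have h3 : HasDerivAt (fun t => cr v1 v2 w1 w2 (100000 * cbrt (x t)) (100000 * √(y t))) _ t :=
    ((h1'.const_sub v1).mul (h2'.const_sub w2)).sub ((h1'.const_sub w1).mul (h2'.const_sub v2))
  refine h3.congr_deriv ?_
  rw [FX_eq hB, FY_eq hB]
  have hu : 0 < cbrt (x t) := cbrt_pos.2 hx
  have hv : 0 < √(y t) := Real.sqrt_pos.2 hy
  have e1 : x t = cbrt (x t) ^ 3 := (cbrt_pow3 _).symm
  have e2 : y t = √(y t) ^ 2 := (Real.sq_sqrt hy.le).symm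
  generalize cbrt (x t) = u at *
  generalize √(y t) = v at *
  rw [e1, e2]
  simp only [hG, _root_.hB, hA]
  field_simp
  ring

/-- all conditions on one quadrilateral -/
def chk8 (p0 p1 p2 p3 q0 q1 q2 q3 u0 u1 v0 v1 : ℤ) : Bool :=
  (decide (0 < u0) && decide (u1 ≤ 130000) && decide (70000 ≤ v0) && decide (v1 ≤ 140000)) &&
  (decide (u0 ≤ p0 ∧ p0 ≤ u1) && decide (u0 ≤ p2 ∧ p2 ≤ u1) && decide (u0 ≤ q0 ∧ q0 ≤ u1) && decide (u0 ≤ q2 ∧ q2 ≤ u1)) &&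
  (decide (v0 ≤ p1 ∧ p1 ≤ v1) && decide (v0 ≤ p3 ∧ p3 ≤ v1) && decide (v0 ≤ q1 ∧ q1 ≤ v1) && decide (v0 ≤ q3 ∧ q3 ≤ v1)) &&
  (decide (0 < crZ p0 p1 q0 q1 p2 p3) && decide (0 < crZ p0 p1 q0 q1 q2 q3) &&
   decide (0 < crZ q2 q3 p2 p3 p0 p1) && decide (0 < crZ q2 q3 p2 p3 q0 q1)) &&
  (decide (0 < crZ p2 p3 p0 p1 q0 q1) && decide (0 < crZ p2 p3 p0 p1 q2 q3) &&
   decide (0 < crZ q0 q1 q2 q3 p0 p1) && decide (0 < crZ q0 q1 q2 q3 p2 p3)) &&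
  (segT 1 p0 p1 (q0 - p0) (q1 - p1) && segT (-1) p2 p3 (q2 - p2) (q3 - p3) &&
   progT (p0 - p2) (p1 - p3) u0 u1 v0 v1)

/-- the state lies on the segment between two points -/
def OnSeg (p0 p1 p2 p3 : ℤ) (x y : ℝ) : Prop :=
  ∃ s : ℝ, 0 ≤ s ∧ s ≤ 1 ∧ 100000 * cbrt x = p0 + (p2 - p0) * s ∧ 100000 * √y = p1 + (p3 - p1) * s

lemma quad_stage {p0 p1 p2 p3 q0 q1 q2 q3 u0 u1 v0 v1 : ℤ}
    (h : chk8 p0 p1 p2 p3 q0 q1 q2 q3 u0 u1 v0 v1 = true) {x y : ℝ → ℝ} {t0 : ℝ} (hs : Sol t0 x y)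
    (hon : OnSeg p0 p1 p2 p3 (x t0) (y t0)) :
    ∃ t1, t0 ≤ t1 ∧ OnSeg q0 q1 q2 q3 (x t1) (y t1) ∧ ∀ t ∈ Icc t0 t1, Bx (x t) (y t) := by
  simp only [chk8, Bool.and_eq_true, decide_eq_true_eq] at h
  obtain ⟨⟨⟨⟨⟨⟨⟨⟨hu0, hu1⟩, hv0⟩, hv1⟩, ⟨⟨⟨a1, a2⟩, a3⟩, a4⟩⟩, ⟨⟨⟨b1, b2⟩, b3⟩, b4⟩⟩,
    ⟨⟨⟨c1, c2⟩, c3⟩, c4⟩⟩, ⟨⟨⟨d1, d2⟩, d3⟩, d4⟩⟩, ⟨⟨s1, s2⟩, s3⟩⟩ := h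
  have lft : ∀ {r1 r2 r3 r4 r5 r6 : ℤ}, 0 < crZ r1 r2 r3 r4 r5 r6 →
      0 < cr (r1:ℝ) r2 r3 r4 r5 r6 := fun hh => by rw [cr_cast]; exact_mod_cast hh
  have C1 := lft c1
  have C2 := lft c2
  have C3 := lft c3
  have C4 := lft c4
  have D1 := lft d1
  have D2 := lft d2
  have D3 := lft d3
  have D4 := lft d4
  have lb : ∀ {l m n : ℤ}, (l ≤ m ∧ m ≤ n) → ((l:ℝ) ≤ m ∧ (m:ℝ) ≤ n) :=
    fun hh => ⟨by exact_mod_cast hh.1, by exact_mod_cast hh.2⟩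
  have hu0' : (0:ℝ) < u0 := by exact_mod_cast hu0
  have hu1' : (u1:ℝ) ≤ 130000 := by exact_mod_cast hu1
  have hv0' : (70000:ℝ) ≤ v0 := by exact_mod_cast hv0
  have hv1' : (v1:ℝ) ≤ 140000 := by exact_mod_cast hv1
  have box : ∀ a b : ℝ, 0 ≤ cr p0 p1 q0 q1 a b → 0 ≤ cr q2 q3 p2 p3 a b → 0 ≤ cr p2 p3 p0 p1 a b →
      0 ≤ cr q0 q1 q2 q3 a b → u0 ≤ a ∧ a ≤ u1 ∧ v0 ≤ b ∧ b ≤ v1 := by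
    intro a b g1 g2 g3 g4
    rcases le_total 0 (cr q2 q3 p0 p1 a b) with hd | hd
    · exact cr_tri g1 g4 hd C2 (lb a1) (lb a3) (lb a4) (lb b1) (lb b3) (lb b4)
    · have hd' : 0 ≤ cr p0 p1 q2 q3 a b := by
        have : cr p0 p1 q2 q3 a b = - cr q2 q3 p0 p1 a b := by simp only [cr]; ring
        linarith
      refine cr_tri hd' g2 g3 ?_ (lb a1) (lb a4) (lb a2) (lb b1) (lb b4) (lb b2)
      have : cr (p0:ℝ) p1 q2 q3 p2 p3 = cr q2 q3 p2 p3 p0 p1 := by simp only [cr]; ring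
      rw [this]; exact C3
  have facts : ∀ t, 0 ≤ cr p0 p1 q0 q1 (100000 * cbrt (x t)) (100000 * √(y t)) →
      0 ≤ cr q2 q3 p2 p3 (100000 * cbrt (x t)) (100000 * √(y t)) →
      0 ≤ cr p2 p3 p0 p1 (100000 * cbrt (x t)) (100000 * √(y t)) →
      0 ≤ cr q0 q1 q2 q3 (100000 * cbrt (x t)) (100000 * √(y t)) →
      0 < x t ∧ Bx (x t) (y t) ∧
      (0 < 12 * (100000 * cbrt (x t)) ^ 2 * (100000 * √(y t)) * 100000 ∧
       12 * (100000 * cbrt (x t)) ^ 2 * (100000 * √(y t)) * 100000 ≤ 12 * 130000 ^ 2 * 140000 * 100000) ∧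
      (u0 ≤ 100000 * cbrt (x t) ∧ 100000 * cbrt (x t) ≤ u1 ∧ v0 ≤ 100000 * √(y t) ∧ 100000 * √(y t) ≤ v1) := by
    intro t g1 g2 g3 g4
    obtain ⟨k1, k2, k3, k4⟩ := box _ _ g1 g2 g3 g4
    have hu : 0 < cbrt (x t) := by linarith
    have hx : 0 < x t := cbrt_pos.1 hu
    have hv : 7/10 ≤ √(y t) := by linarith
    have hv2 : √(y t) ≤ 14/10 := by linarith
    have hy : 0 ≤ y t := by
      by_contra hc
      rw [Real.sqrt_eq_zero_of_nonpos (by linarith)] at hv; norm_num at hv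
    have hsq := Real.sq_sqrt hy
    have hx3 : x t ≤ (13/10) ^ 3 := cbrt_le_iff.1 (by linarith)
    refine ⟨hx, ⟨by linarith, by norm_num at hx3; linarith, by nlinarith, by nlinarith⟩, ⟨by positivity, ?_⟩, k1, k2, k3, k4⟩
    have e1 : 100000 * cbrt (x t) ≤ 130000 := by linarith
    have e2 : 100000 * √(y t) ≤ 140000 := by linarith
    gcongr
  have hcont : ∀ v1 v2 w1 w2 : ℝ, ∀ t, t0 ≤ t →
      ContinuousAt (fun t => cr v1 v2 w1 w2 (100000 * cbrt (x t)) (100000 * √(y t))) t := by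
    intro v1 v2 w1 w2 t ht
    have k1 : ContinuousAt (fun t => 100000 * cbrt (x t)) t :=
      continuousAt_const.mul ((cbrt_cont.continuousAt).comp (hs.contx ht))
    have k2 : ContinuousAt (fun t => 100000 * √(y t)) t := continuousAt_const.mul (hs.conty ht).sqrt
    exact ((continuousAt_const.sub k1).mul (continuousAt_const.sub k2)).sub
      ((continuousAt_const.sub k1).mul (continuousAt_const.sub k2))
  obtain ⟨s, hs0, hs1, ea, eb⟩ := hon
  have i1 : cr p0 p1 q0 q1 (100000 * cbrt (x t0)) (100000 * √(y t0)) = s * cr p0 p1 q0 q1 p2 p3 := by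
    rw [ea, eb]; simp only [cr]; ring
  have i2 : cr q2 q3 p2 p3 (100000 * cbrt (x t0)) (100000 * √(y t0)) = (1 - s) * cr q2 q3 p2 p3 p0 p1 := by
    rw [ea, eb]; simp only [cr]; ring
  have i3 : cr p2 p3 p0 p1 (100000 * cbrt (x t0)) (100000 * √(y t0)) = 0 := by
    rw [ea, eb]; simp only [cr]; ring
  have i4 : cr q0 q1 q2 q3 (100000 * cbrt (x t0)) (100000 * √(y t0)) =
      (1 - s) * cr q0 q1 q2 q3 p0 p1 + s * cr q0 q1 q2 q3 p2 p3 := by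
    rw [ea, eb]; simp only [cr]; ring
  have hs1' : 0 ≤ 1 - s := by linarith
  have prog : ∀ t, t0 ≤ t → 0 ≤ cr p0 p1 q0 q1 (100000 * cbrt (x t)) (100000 * √(y t)) →
      0 ≤ cr q2 q3 p2 p3 (100000 * cbrt (x t)) (100000 * √(y t)) →
      0 ≤ cr p2 p3 p0 p1 (100000 * cbrt (x t)) (100000 * √(y t)) →
      0 ≤ cr q0 q1 q2 q3 (100000 * cbrt (x t)) (100000 * √(y t)) →
      ∃ d, (1 / (12 * 130000 ^ 2 * 140000 * 100000) : ℝ) ≤ d ∧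
        HasDerivAt (fun t => cr p2 p3 p0 p1 (100000 * cbrt (x t)) (100000 * √(y t))) d t := by
    intro t ht g1 g2 g3 gh
    obtain ⟨hx, hB, ⟨hp, hp'⟩, k1, k2, k3, k4⟩ := facts t g1 g2 g3 gh
    refine ⟨_, ?_, cr_deriv hs ht hx hB _ _ _ _⟩
    have := progT_sound s3 hu0 hv0 k1 k2 k3 k4
    push_cast at this
    exact div_le_div₀ (by linarith) this hp hp'
  obtain ⟨t1, ht1, he, hin, _⟩ := stage
    (fun t => cr p0 p1 q0 q1 (100000 * cbrt (x t)) (100000 * √(y t)))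
    (fun t => cr q2 q3 p2 p3 (100000 * cbrt (x t)) (100000 * √(y t)))
    (fun t => cr p2 p3 p0 p1 (100000 * cbrt (x t)) (100000 * √(y t)))
    (fun t => cr q0 q1 q2 q3 (100000 * cbrt (x t)) (100000 * √(y t)))
    (fun t => cr p2 p3 p0 p1 (100000 * cbrt (x t)) (100000 * √(y t))) t0
    (1 / (12 * 130000 ^ 2 * 140000 * 100000)) (2 * (300000 * 300000)) (by norm_num)
    (by rw [i1]; positivity) (by rw [i2]; positivity) (by rw [i3])
    (by rw [i4]; positivity)
    (hcont _ _ _ _) (hcont _ _ _ _) (hcont _ _ _ _) (hcont _ _ _ _)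
    (by
      intro t ht g2 g3 gh g1
      obtain ⟨hx, hB, ⟨hp, _⟩, _⟩ := facts t g1.ge g2 g3 gh.le
      refine ⟨_, div_pos ?_ hp, cr_deriv hs ht hx hB _ _ _ _⟩
      obtain ⟨r, hr0, hr1, e1, e2⟩ := cr_wall g1 g3 gh.le D1 D3
      have := segT_sound s1 (Or.inl rfl) r hr0 hr1
      push_cast at this
      rw [one_mul] at this
      rw [e1, e2]
      exact this)
    (by
      intro t ht g1 g3 gh g2
      obtain ⟨hx, hB, ⟨hp, _⟩, _⟩ := facts t g1 g2.ge g3 gh.le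
      refine ⟨_, div_pos ?_ hp, cr_deriv hs ht hx hB _ _ _ _⟩
      obtain ⟨r, hr0, hr1, e1, e2⟩ := cr_wall g2 gh.le g3 D4 D2
      have := segT_sound s2 (Or.inr rfl) (1 - r) (by linarith) (by linarith)
      push_cast at this
      rw [e1, e2]
      have f1 : (q2:ℝ) + (p2 - q2) * r = p2 + (q2 - p2) * (1 - r) := by ring
      have f2 : (q3:ℝ) + (p3 - q3) * r = p3 + (q3 - p3) * (1 - r) := by ring
      rw [f1, f2]
      refine lt_of_lt_of_eq this ?_
      unfold hG; ring)
    (by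
      intro t ht g1 g2 gh g3
      obtain ⟨d, hd, hd'⟩ := prog t ht g1 g2 g3.ge gh.le
      exact ⟨d, lt_of_lt_of_le (by norm_num) hd, hd'⟩)
    (by
      intro t ht g1 g2 g3 gh
      refine ⟨?_, prog t ht g1 g2 g3 gh.le⟩
      obtain ⟨hx, hB, ⟨hp, hp'⟩, k1, k2, k3, k4⟩ := facts t g1 g2 g3 gh.le
      have A1 := lb a1
      have A2 := lb a2
      have B1 := lb b1
      have B2 := lb b2
      have n : ∀ m n : ℝ, |m| ≤ 300000 → |n| ≤ 300000 → |m * n| ≤ 300000 * 300000 := fun m n h1 h2 => by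
        rw [abs_mul]; gcongr
      have m1 := n (p2 - 100000 * cbrt (x t)) (p1 - 100000 * √(y t))
        (by rw [abs_le]; constructor <;> linarith [A1.1, A1.2, A2.1, A2.2, B1.1, B1.2, B2.1, B2.2])
        (by rw [abs_le]; constructor <;> linarith [A1.1, A1.2, A2.1, A2.2, B1.1, B1.2, B2.1, B2.2])
      have m2 := n (p0 - 100000 * cbrt (x t)) (p3 - 100000 * √(y t))
        (by rw [abs_le]; constructor <;> linarith [A1.1, A1.2, A2.1, A2.2, B1.1, B1.2, B2.1, B2.2])
        (by rw [abs_le]; constructor <;> linarith [A1.1, A1.2, A2.1, A2.2, B1.1, B1.2, B2.1, B2.2])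
      rw [abs_le] at m1 m2
      simp only [cr]
      linarith [m1.1, m1.2, m2.1, m2.2])
  refine ⟨t1, ht1, ?_, ?_⟩
  · obtain ⟨g1, g2, g3, gh⟩ := hin t1 (right_mem_Icc.2 ht1)
    exact cr_wall he g1 g2 C2 C4
  · intro t ht
    obtain ⟨g1, g2, g3, gh⟩ := hin t ht
    exact (facts t g1 g2 g3 gh).2.1

/-- a row of the table: inner and outer endpoint of a transversal segment -/
structure Row where
  /-- inner, first coordinate -/
  a : ℤ
  /-- inner, second coordinate -/
  b : ℤ
  /-- outer, first coordinate -/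
  c : ℤ
  /-- outer, second coordinate -/
  d : ℤ

/-- check of the quadrilateral between two consecutive rows -/
def chkQ (p q : Row) : Bool :=
  chk8 p.a p.b p.c p.d q.a q.b q.c q.d
    (min (min p.a p.c) (min q.a q.c)) (max (max p.a p.c) (max q.a q.c))
    (min (min p.b p.d) (min q.b q.d)) (max (max p.b p.d) (max q.b q.d))

/-- check of a chain of quadrilaterals -/
def chkL : Row → List Row → Bool
  | _, [] => true
  | p, q :: l => chkQ p q && chkL q l

/-- last element of a chain -/
def lastR : Row → List Row → Row
  | p, [] => p
  | _, q :: l => lastR q l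

lemma chain_stage (l : List Row) : ∀ (p : Row), chkL p l = true → ∀ {x y : ℝ → ℝ} {t0 : ℝ}, Sol t0 x y →
    OnSeg p.a p.b p.c p.d (x t0) (y t0) → Bx (x t0) (y t0) →
    ∃ t1, t0 ≤ t1 ∧ OnSeg (lastR p l).a (lastR p l).b (lastR p l).c (lastR p l).d (x t1) (y t1) ∧
      ∀ t ∈ Icc t0 t1, Bx (x t) (y t) := by
  induction l with
  | nil =>
    intro p _ x y t0 _ hon hb
    refine ⟨t0, le_rfl, hon, fun t ht => ?_⟩
    rw [le_antisymm ht.2 ht.1]; exact hb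
  | cons q l ih =>
    intro p hc x y t0 hs hon _
    simp only [chkL, Bool.and_eq_true] at hc
    obtain ⟨t1, ht1, hon1, hb1⟩ := quad_stage hc.1 hs hon
    obtain ⟨t2, ht2, hon2, hb2⟩ := ih q hc.2 (hs.mono ht1) hon1 (hb1 t1 (right_mem_Icc.2 ht1))
    refine ⟨t2, ht1.trans ht2, hon2, fun t ht => ?_⟩
    rcases le_total t t1 with h | h
    · exact hb1 t ⟨ht.1, h⟩
    · exact hb2 t ⟨h, ht.2⟩

/-- the table of transversal segments -/
def rows : List Row := [
  ⟨25152, 109073, 20364, 109073⟩,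
  ⟨25251, 109165, 20795, 109165⟩,
  ⟨25336, 109239, 21124, 109239⟩,
  ⟨25501, 109369, 21670, 109369⟩,
  ⟨25763, 109554, 22398, 109554⟩,
  ⟨26115, 109778, 23208, 109778⟩,
  ⟨26777, 110152, 24447, 110152⟩,
  ⟨27975, 110755, 26250, 110755⟩,
  ⟨30662, 111966, 29525, 111966⟩,
  ⟨41375, 116401, 40868, 116554⟩,
  ⟨50970, 120225, 50548, 120518⟩,
  ⟨58109, 122969, 57731, 123388⟩,
  ⟨64156, 125195, 63830, 125739⟩,
  ⟨69383, 127020, 69123, 127690⟩,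
  ⟨73922, 128511, 73667, 129279⟩,
  ⟨78024, 129768, 77757, 130628⟩,
  ⟨81669, 130798, 81396, 131750⟩,
  ⟨84948, 131644, 84673, 132688⟩,
  ⟨87953, 132342, 87681, 133479⟩,
  ⟨90581, 132882, 90318, 134110⟩,
  ⟨92925, 133301, 92676, 134618⟩,
  ⟨95178, 133642, 94948, 135054⟩,
  ⟨97141, 133883, 96935, 135385⟩,
  ⟨99008, 134058, 98832, 135654⟩,
  ⟨100679, 134164, 100538, 135852⟩,
  ⟨102151, 134215, 102049, 135990⟩,
  ⟨103522, 134222, 103465, 136085⟩,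
  ⟨104791, 134191, 104783, 136140⟩,
  ⟨105957, 134126, 106004, 136160⟩,
  ⟨107019, 134034, 107126, 136150⟩,
  ⟨108075, 133910, 108250, 136111⟩,
  ⟨108931, 133782, 109170, 136055⟩,
  ⟨109779, 133628, 110091, 135976⟩,
  ⟨110618, 133449, 111013, 135873⟩,
  ⟨111354, 133266, 111832, 135759⟩,
  ⟨111990, 133088, 112548, 135641⟩,
  ⟨112617, 132891, 113263, 135505⟩,
  ⟨113147, 132709, 113875, 135373⟩,
  ⟨113668, 132512, 114485, 135226⟩,
  ⟨114181, 132302, 115094, 135063⟩,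
  ⟨114683, 132078, 115700, 134884⟩,
  ⟨115094, 131880, 116203, 134722⟩,
  ⟨115498, 131672, 116703, 134547⟩,
  ⟨115892, 131455, 117201, 134360⟩,
  ⟨116278, 131228, 117695, 134159⟩,
  ⟨116655, 130991, 118186, 133944⟩,
  ⟨116986, 130770, 118624, 133738⟩,
  ⟨117343, 130515, 119106, 133496⟩,
  ⟨117622, 130305, 119487, 133291⟩,
  ⟨117893, 130089, 119865, 133076⟩,
  ⟨118157, 129868, 120238, 132851⟩,
  ⟨118414, 129641, 120606, 132616⟩,
  ⟨118633, 129438, 120924, 132401⟩,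
  ⟨118876, 129202, 121282, 132147⟩,
  ⟨119082, 128991, 121590, 131915⟩,
  ⟨119310, 128745, 121937, 131641⟩,
  ⟨119503, 128526, 122234, 131392⟩,
  ⟨119691, 128304, 122525, 131136⟩,
  ⟨119846, 128111, 122770, 130909⟩,
  ⟨120022, 127882, 123050, 130638⟩,
  ⟨120193, 127651, 123323, 130359⟩,
  ⟨120379, 127382, 123627, 130032⟩,
  ⟨120492, 127212, 123812, 129822⟩,
  ⟨120602, 127041, 123993, 129608⟩,
  ⟨120751, 126798, 124240, 129304⟩,
  ⟨120873, 126588, 124445, 129037⟩,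
  ⟨121011, 126340, 124677, 128720⟩,
  ⟨121143, 126089, 124901, 128397⟩,
  ⟨121268, 125835, 125116, 128068⟩,
  ⟨121388, 125579, 125323, 127734⟩,
  ⟨121503, 125320, 125521, 127394⟩,
  ⟨121611, 125059, 125710, 127049⟩,
  ⟨121714, 124795, 125890, 126700⟩,
  ⟨121810, 124529, 126061, 126346⟩,
  ⟨121902, 124260, 126224, 125989⟩,
  ⟨121999, 123950, 126399, 125576⟩,
  ⟨122078, 123676, 126542, 125211⟩,
  ⟨122161, 123361, 126696, 124790⟩,
  ⟨122237, 123043, 126838, 124366⟩,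
  ⟨122314, 122682, 126985, 123886⟩,
  ⟨122382, 122317, 127118, 123403⟩,
  ⟨122434, 121991, 127225, 122970⟩,
  ⟨122479, 121663, 127321, 122537⟩,
  ⟨122522, 121291, 127417, 122047⟩,
  ⟨122558, 120876, 127510, 121501⟩,
  ⟨122582, 120499, 127580, 121009⟩,
  ⟨122598, 120079, 127644, 120461⟩,
  ⟨122603, 119657, 127694, 119912⟩,
  ⟨122597, 119233, 127731, 119364⟩,
  ⟨122581, 118808, 127754, 118816⟩,
  ⟨122555, 118381, 127765, 118268⟩,
  ⟨122518, 117954, 127763, 117722⟩,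
  ⟨122462, 117441, 127745, 117067⟩,
  ⟨122391, 116928, 127711, 116414⟩,
  ⟨122306, 116414, 127661, 115764⟩,
  ⟨122208, 115902, 127596, 115115⟩,
  ⟨122096, 115390, 127516, 114470⟩,
  ⟨121950, 114795, 127405, 113720⟩,
  ⟨121787, 114202, 127276, 112974⟩,
  ⟨121581, 113529, 127107, 112127⟩,
  ⟨121353, 112860, 126916, 111286⟩,
  ⟨121074, 112113, 126677, 110347⟩,
  ⟨120805, 111456, 126442, 109519⟩,
  ⟨120480, 110725, 126155, 108595⟩,
  ⟨120132, 110002, 125844, 107679⟩,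
  ⟨119763, 109289, 125511, 106772⟩,
  ⟨119328, 108508, 125115, 105774⟩,
  ⟨118869, 107741, 124693, 104787⟩,
  ⟨118386, 106989, 124245, 103811⟩,
  ⟨117829, 106177, 123725, 102750⟩,
  ⟨117299, 105456, 123227, 101798⟩,
  ⟨116750, 104750, 122705, 100858⟩,
  ⟨116123, 103993, 122105, 99838⟩,
  ⟨115474, 103255, 121479, 98832⟩,
  ⟨114803, 102539, 120826, 97842⟩,
  ⟨114113, 101844, 120147, 96868⟩,
  ⟨113403, 101170, 119444, 95910⟩,
  ⟨112676, 100518, 118715, 94968⟩,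
  ⟨111932, 99887, 117962, 94043⟩,
  ⟨111172, 99279, 117185, 93136⟩,
  ⟨110397, 98694, 116384, 92247⟩,
  ⟨109535, 98080, 115485, 91299⟩,
  ⟨108732, 97540, 114636, 90450⟩,
  ⟨107917, 97023, 113766, 89621⟩,
  ⟨107090, 96527, 112874, 88813⟩,
  ⟨106252, 96053, 111961, 88026⟩,
  ⟨105327, 95561, 110943, 87192⟩,
  ⟨104469, 95131, 109988, 86451⟩,
  ⟨103522, 94686, 108926, 85669⟩,
  ⟨102646, 94299, 107933, 84977⟩,
  ⟨101681, 93899, 106831, 84249⟩,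
  ⟨100707, 93523, 105709, 83550⟩,
  ⟨99724, 93168, 104570, 82880⟩,
  ⟨98733, 92836, 103414, 82240⟩,
  ⟨97734, 92524, 102243, 81630⟩,
  ⟨96727, 92233, 101058, 81049⟩,
  ⟨95627, 91940, 99760, 80453⟩,
  ⟨94519, 91669, 98450, 79891⟩,
  ⟨93402, 91421, 97127, 79363⟩,
  ⟨92191, 91176, 95693, 78831⟩,
  ⟨90970, 90955, 94249, 78336⟩,
  ⟨89651, 90743, 92693, 77846⟩,
  ⟨88234, 90544, 91026, 77366⟩,
  ⟨86806, 90371, 89353, 76929⟩,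
  ⟨85276, 90216, 87572, 76509⟩,
  ⟨83644, 90080, 85684, 76111⟩,
  ⟨81816, 89963, 83585, 75720⟩,
  ⟨79788, 89872, 81279, 75347⟩,
  ⟨77557, 89813, 78767, 75002⟩,
  ⟨75025, 89793, 75950, 74680⟩,
  ⟨72187, 89822, 72833, 74395⟩,
  ⟨68846, 89913, 69214, 74141⟩,
  ⟨64799, 90090, 64898, 73925⟩,
  ⟨59837, 90380, 59693, 73760⟩,
  ⟨53350, 90832, 53010, 73652⟩,
  ⟨44311, 91516, 43871, 73602⟩,
  ⟨32378, 92369, 32004, 73577⟩,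
  ⟨20383, 93057, 20177, 73508⟩,
  ⟨8390, 93532, 8344, 73374⟩,
  ⟨5074, 93629, 5056, 73328⟩,
  ⟨5000, 93700, 5000, 73300⟩]

lemma rows_ok : chkL ⟨25080, 109000, 20000, 109000⟩ rows = true := by decide +kernel

lemma rows_last : lastR ⟨25080, 109000, 20000, 109000⟩ rows = ⟨5000, 93700, 5000, 73300⟩ := by
  rfl

/-! ### Part 8: the periodic orbit and its isolation -/

lemma sol_unique {x y x' y' : ℝ → ℝ} {a : ℝ} (h : Sol a x y) (h' : Sol a x' y')
    (ex : x a = x' a) (ey : y a = y' a) : ∀ t, a ≤ t → x t = x' t ∧ y t = y' t := by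
  intro t ht
  have := cmp_sol cc cc cc_mono 0 (by simp) x y x' y' a t ht
    (fun s hs => (h s hs.1).1) (fun s hs => (h s hs.1).2)
    (fun s hs => (h' s hs.1).1) (fun s hs => (h' s hs.1).2)
  rw [ex, ey] at this
  simp only [sub_self] at this
  have e1 : (x t - x' t) ^ 2 = 0 := by nlinarith [sq_nonneg (x t - x' t), sq_nonneg (y t - y' t)]
  have e2 : (y t - y' t) ^ 2 = 0 := by nlinarith [sq_nonneg (x t - x' t), sq_nonneg (y t - y' t)]
  exact ⟨sub_eq_zero.1 (pow_eq_zero_iff (by norm_num) |>.1 e1),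
    sub_eq_zero.1 (pow_eq_zero_iff (by norm_num) |>.1 e2)⟩

lemma Sol.shift {x y : ℝ → ℝ} {a : ℝ} (h : Sol a x y) (c : ℝ) :
    Sol (a - c) (fun t => x (t + c)) (fun t => y (t + c)) := by
  intro t ht
  have := h (t + c) (by linarith)
  exact ⟨this.1.comp_add_const t c, this.2.comp_add_const t c⟩

lemma return_stage {x y : ℝ → ℝ} {t0 : ℝ} (hs : Sol t0 x y) (hx0 : x t0 = 0) (hy0 : y t0 = 1) :
    ∃ t1, t0 < t1 ∧ x t1 = 0 ∧ y t1 = 1 ∧ (∀ t ∈ Icc t0 t1, Bx (x t) (y t)) ∧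
      ∃ tm ∈ Icc t0 t1, x tm = 0 ∧ 537/1000 ≤ y tm ∧ y tm ≤ 88/100 := by
  obtain ⟨ta, ha, hya, hl, hu, hBa⟩ := O_stage hs hx0 hy0
  have sa := hs.mono ha.le
  have hseg : OnSeg 25080 109000 20000 109000 (x ta) (y ta) := by
    refine ⟨(25080 - 100000 * cbrt (x ta)) / 5080, ?_, ?_, ?_, ?_⟩
    · apply div_nonneg <;> linarith
    · rw [div_le_one (by norm_num)]; linarith
    · push_cast; ring
    · push_cast; rw [hya]; ring
  obtain ⟨tb, hab, hsegb, hBb⟩ := chain_stage rows ⟨25080, 109000, 20000, 109000⟩ rows_ok sa hseg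
    (hBa ta ⟨ha.le, le_rfl⟩)
  rw [rows_last] at hsegb
  obtain ⟨s, hs0, hs1, e1, e2⟩ := hsegb
  push_cast at e1 e2
  have sb := sa.mono hab
  obtain ⟨tc, hbc, hxc, hyc1, hyc2, hBc⟩ := final_stage sb (by linarith) (by linarith) (by linarith)
  have sc := sb.mono hbc
  have hK : KL (x tc) (y tc) := by
    have r1 : 73/100 ≤ √(y tc) := Real.le_sqrt_of_sq_le (by linarith)
    have r2 : √(y tc) ≤ 1 := Real.sqrt_le_one.2 (by linarith)
    refine ⟨hxc.le, by linarith, by linarith, ?_⟩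
    rw [hxc, zero_add]
    apply pow_nonneg
    apply mul_nonneg <;> linarith
  obtain ⟨td, hcd, hxd, hyd, hBd⟩ := KL_stage sc hK
  refine ⟨td, by linarith, hxd, hyd, ?_, tc, ⟨by linarith, hcd⟩, hxc, hyc1, hyc2⟩
  rintro t ⟨h1, h2⟩
  rcases le_total t ta with h | h
  · exact hBa t ⟨h1, h⟩
  rcases le_total t tb with h' | h'
  · exact hBb t ⟨h, h'⟩
  rcases le_total t tc with h'' | h''
  · exact hBc t ⟨h', h''⟩
  · exact hBd t ⟨h'', h2⟩

lemma base_sol : ∃ (τ : ℝ) (x y : ℝ → ℝ), Sol τ x y ∧ x τ = 0 ∧ y τ = 1 := by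
  obtain ⟨x, y, hx, hy, hb⟩ := exists_sol (-1/1000) (9/10)
  have hs : Sol (1/1000000) x y := fun t ht => ⟨hx t (by linarith), hy t (by linarith)⟩
  have hb1 := (hb (1/1000000) (by norm_num)).1
  have hb2 := (hb (1/1000000) (by norm_num)).2
  rw [abs_le] at hb1 hb2
  have hK : KL (x (1/1000000)) (y (1/1000000)) := by
    set X := x (1/1000000)
    set Y := y (1/1000000)
    have r1 : 94/100 ≤ √Y := Real.le_sqrt_of_sq_le (by linarith)
    have r2 : √Y ≤ 95/100 := Real.sqrt_le_iff.2 ⟨by norm_num, by linarith⟩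
    refine ⟨by linarith, by linarith, by linarith, ?_⟩
    have : (2/10 : ℝ) ^ 3 ≤ ((1-√Y)*(61/10-16*(1-√Y)))^3 := by
      apply pow_le_pow_left₀ (by norm_num)
      nlinarith
    norm_num at this
    linarith
  obtain ⟨t1, h1, h2, h3, _⟩ := KL_stage hs hK
  exact ⟨t1, x, y, hs.mono h1, h2, h3⟩

lemma exists_cycle : ∃ (T : ℝ) (X Y : ℝ → ℝ), 0 < T ∧ Function.Periodic X T ∧
    Function.Periodic Y T ∧ (∀ a, Sol a X Y) ∧ (∀ t, Bx (X t) (Y t)) ∧ X 0 = 0 ∧ Y 0 = 1 ∧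
    ∃ tm, X tm = 0 ∧ 537/1000 ≤ Y tm ∧ Y tm ≤ 88/100 := by
  obtain ⟨τ, x0, y0, hs0, hx0, hy0⟩ := base_sol
  obtain ⟨x, hx⟩ : ∃ x : ℝ → ℝ, x = fun t => x0 (t + τ) := ⟨_, rfl⟩
  obtain ⟨y, hy⟩ : ∃ y : ℝ → ℝ, y = fun t => y0 (t + τ) := ⟨_, rfl⟩
  have hs : Sol 0 x y := by
    have := hs0.shift τ
    rw [sub_self] at this
    rw [hx, hy]; exact this
  have hx0 : x 0 = 0 := by rw [hx]; simpa using hx0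
  have hy0 : y 0 = 1 := by rw [hy]; simpa using hy0
  obtain ⟨T, hT, hxT, hyT, hB, tm, htm, hm1, hm2, hm3⟩ := return_stage hs hx0 hy0
  have hper : ∀ t, 0 ≤ t → x (t + T) = x t ∧ y (t + T) = y t := by
    have h1 : Sol 0 (fun t => x (t + T)) (fun t => y (t + T)) := (hs.shift T).mono (by linarith)
    exact sol_unique h1 hs (by simp [hxT, hx0]) (by simp [hyT, hy0])
  have hpern : ∀ (n : ℕ) (t : ℝ), 0 ≤ t → x (t + n * T) = x t ∧ y (t + n * T) = y t := by
    intro n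
    induction n with
    | zero => intro t _; simp
    | succ k ih =>
      intro t ht
      have e : t + ((k + 1 : ℕ) : ℝ) * T = (t + k * T) + T := by push_cast; ring
      have h2 := hper (t + k * T) (by positivity)
      rw [e, h2.1, h2.2]
      exact ih t ht
  have hfr : ∀ t, 0 ≤ t → x (Int.fract (t / T) * T) = x t ∧ y (Int.fract (t / T) * T) = y t := by
    intro t ht
    have h0 : 0 ≤ ⌊t / T⌋ := Int.floor_nonneg.2 (by positivity)
    obtain ⟨n, hn⟩ := Int.eq_ofNat_of_zero_le h0
    have h1 := hpern n (Int.fract (t / T) * T) (mul_nonneg (Int.fract_nonneg _) hT.le)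
    have e : Int.fract (t / T) * T + n * T = t := by
      have := Int.fract_add_floor (t / T)
      rw [hn] at this
      push_cast at this
      rw [← add_mul, this]
      field_simp
    rw [e] at h1
    exact ⟨h1.1.symm, h1.2.symm⟩
  have pX : Function.Periodic (fun t => x (Int.fract (t / T) * T)) T := by
    intro t
    simp only [add_div, div_self hT.ne', Int.fract_add_one]
  have pY : Function.Periodic (fun t => y (Int.fract (t / T) * T)) T := by
    intro t
    simp only [add_div, div_self hT.ne', Int.fract_add_one]
  refine ⟨T, fun t => x (Int.fract (t / T) * T), fun t => y (Int.fract (t / T) * T), hT, pX, pY,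
    ?_, ?_, by simp [hx0], by simp [hy0], tm, ?_⟩
  · intro a t _
    have key : ∀ t, 0 < t →
        HasDerivAt (fun t => x (Int.fract (t / T) * T)) (FX cc (x (Int.fract (t / T) * T)) (y (Int.fract (t / T) * T))) t ∧
        HasDerivAt (fun t => y (Int.fract (t / T) * T)) (FY (x (Int.fract (t / T) * T)) (y (Int.fract (t / T) * T))) t := by
      intro t ht
      rw [(hfr t ht.le).1, (hfr t ht.le).2]
      have h1 := hs t ht.le
      constructor
      · apply h1.1.congr_of_eventuallyEq
        filter_upwards [lt_mem_nhds ht] with s hs using (hfr s hs.le).1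
      · apply h1.2.congr_of_eventuallyEq
        filter_upwards [lt_mem_nhds ht] with s hs using (hfr s hs.le).2
    obtain ⟨n, hn⟩ := exists_nat_gt (-t / T)
    rw [div_lt_iff₀ hT] at hn
    have k := key (t + n * T) (by linarith)
    have eX : ∀ s, x (Int.fract ((s + n * T) / T) * T) = x (Int.fract (s / T) * T) := fun s =>
      pX.nat_mul n s
    have eY : ∀ s, y (Int.fract ((s + n * T) / T) * T) = y (Int.fract (s / T) * T) := fun s =>
      pY.nat_mul n s
    have k1 := k.1.comp_add_const t (n * T)
    have k2 := k.2.comp_add_const t (n * T)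
    simp only [eX, eY] at k1 k2
    exact ⟨k1, k2⟩
  · intro t
    refine hB _ ⟨mul_nonneg (Int.fract_nonneg _) hT.le, ?_⟩
    have := (Int.fract_lt_one (t / T)).le
    nlinarith
  · show x (Int.fract (tm / T) * T) = 0 ∧ 537/1000 ≤ y (Int.fract (tm / T) * T) ∧ y (Int.fract (tm / T) * T) ≤ 88/100
    rw [(hfr tm htm.1).1, (hfr tm htm.1).2]
    exact ⟨hm1, hm2, hm3⟩

/-- the open core of the left funnel -/
def KI : Set (ℝ × ℝ) := {z | z.1 < 0 ∧ 5329/10000 < z.2 ∧ z.2 < 1 ∧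
    0 < z.1 + ((1-√z.2)*(61/10-16*(1-√z.2)))^3}

lemma KI_open : IsOpen KI := by
  unfold KI
  simp only [Set.ofPred_and]
  apply_rules [IsOpen.inter, isOpen_lt] <;> fun_prop

lemma enters_KI {X Y : ℝ → ℝ} (hs : ∀ a, Sol a X Y) (hB : ∀ t, Bx (X t) (Y t)) {tm : ℝ}
    (h1 : X tm = 0) (h2 : 537/1000 ≤ Y tm) (h3 : Y tm ≤ 88/100) : ∃ s, (X s, Y s) ∈ KI := by
  have hd := (hs tm tm le_rfl).1
  have cX := (hs tm).contx le_rfl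
  have cY := (hs tm).conty le_rfl
  have r1 : 732/1000 ≤ √(Y tm) := Real.le_sqrt_of_sq_le (by linarith)
  have r2 : √(Y tm) ≤ 95/100 := Real.sqrt_le_iff.2 ⟨by norm_num, by linarith⟩
  have r3 := Real.sq_sqrt (show 0 ≤ Y tm by linarith)
  rw [FX_eq (hB tm), h1, cbrt_zero] at hd
  have e1 := pos_right (g := fun t => - X t) (d := -(-3 * 0 + 0 + 8 * (Y tm - √(Y tm))))
    (by nlinarith) (by simp [h1]) hd.neg
  have e2 : ∀ᶠ s in nhds tm, 5329/10000 < Y s := cY.eventually (lt_mem_nhds (by linarith))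
  have e3 : ∀ᶠ s in nhds tm, Y s < 1 := cY.eventually (gt_mem_nhds (by linarith))
  have e4 : ∀ᶠ s in nhds tm, 0 < X s + ((1-√(Y s))*(61/10-16*(1-√(Y s))))^3 := by
    have c : ContinuousAt (fun s => X s + ((1-√(Y s))*(61/10-16*(1-√(Y s))))^3) tm := by fun_prop
    refine c.eventually (lt_mem_nhds ?_)
    show 0 < X tm + _
    rw [h1, zero_add]
    apply pow_pos
    apply mul_pos <;> linarith
  obtain ⟨s, k1, k2, k3, k4⟩ := (e1.and ((e2.and (e3.and e4)).filter_mono nhdsWithin_le_nhds)).exists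
  exact ⟨s, by simpa using k1, k2, k3, k4⟩

/-- the field of the system -/
def VF (z : ℝ × ℝ) : ℝ × ℝ :=
  (0 + 1 * z.1 + 8 * z.2 + (-3) * cbrt z.1 + (-8) * oddSqrt z.2,
   0 + (-1) * z.1 + 1 * z.2 + 0 * cbrt z.1 + (-1/2) * oddSqrt z.2)

lemma VF_eq {z : ℝ × ℝ} (h1 : -8 ≤ z.1) (h2 : z.1 ≤ 8) (h3 : 1/16 ≤ z.2) (h4 : z.2 ≤ 16) :
    VF z = (FX cc z.1 z.2, FY z.1 z.2) := by
  unfold VF FX FY cc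
  rw [cx_eq h1 h2, cy_eq h3 h4, oddSqrt_of_pos (by linarith)]
  ext <;> simp only <;> ring

lemma VF_neg (z : ℝ × ℝ) : VF (-z) = -VF z := by
  unfold VF
  ext <;> simp only [Prod.fst_neg, Prod.snd_neg, cbrt_neg, oddSqrt_neg] <;> ring

lemma main_cycle_s10 : ∃ φ : ℝ → ℝ × ℝ, IsLimitCycle VF φ ∧ φ 0 = (0, 1) ∧ ∀ t, 0 < (φ t).2 := by
  obtain ⟨T, X, Y, hT, pX, pY, hs, hB, hX0, hY0, tm, hm1, hm2, hm3⟩ := exists_cycle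
  obtain ⟨s1, hs1⟩ := enters_KI hs hB hm1 hm2 hm3
  obtain ⟨ρ, hρ, hball⟩ := Metric.isOpen_iff.1 KI_open _ hs1
  refine ⟨fun t => (X t, Y t), ⟨⟨?_, ⟨T, hT, ?_⟩, ?_⟩, ?_⟩, by simp [hX0, hY0],
    fun t => by have := (hB t).2.2.1; simp only; linarith⟩
  · intro t
    have h := hB t
    obtain ⟨h1, h2, h3, h4⟩ := h
    rw [VF_eq (by simp only; linarith) (by simp only; linarith) (by simp only; linarith) (by simp only; linarith)]
    exact (hs t t le_rfl).1.prodMk (hs t t le_rfl).2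
  · intro t
    simp only [pX t, pY t]
  · rintro ⟨c, hc⟩
    have h1 := congrArg Prod.snd ((hc 0).trans (hc tm).symm)
    simp only [hY0] at h1
    linarith
  · obtain ⟨E, hE⟩ : ∃ E, E = Real.exp (40 * T) := ⟨_, rfl⟩
    have hE1 : 0 < E := hE ▸ Real.exp_pos _
    obtain ⟨δ, hδ0, hδ1, hδ2⟩ : ∃ δ : ℝ, 0 < δ ∧ δ ≤ 1/16 ∧ 2 * δ ^ 2 * E < ρ ^ 2 := by
      have c : Filter.Tendsto (fun δ : ℝ => 2 * δ ^ 2 * E) (nhdsWithin 0 (Ioi 0)) (nhds (2 * 0 ^ 2 * E)) :=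
        (Continuous.tendsto (by fun_prop) 0).mono_left nhdsWithin_le_nhds
      have e1 := c.eventually (gt_mem_nhds (show 2 * 0 ^ 2 * E < ρ ^ 2 by simp; positivity))
      have e2 : ∀ᶠ δ : ℝ in nhdsWithin 0 (Ioi 0), δ < 1/16 :=
        nhdsWithin_le_nhds (gt_mem_nhds (by norm_num))
      obtain ⟨δ, h1, h2, h3⟩ := (e1.and (e2.and self_mem_nhdsWithin)).exists
      exact ⟨δ, h3, h2.le, h1⟩
    refine ⟨⋃ b, Metric.ball (X b, Y b) δ, isOpen_iUnion fun b => Metric.isOpen_ball, ?_, ?_⟩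
    · rintro _ ⟨t, rfl⟩
      exact mem_iUnion.2 ⟨t, Metric.mem_ball_self hδ0⟩
    · rintro ψ ⟨hsol, ⟨T', hT', pψ⟩, -⟩ hU
      have hcl : ∀ t, ∃ b, |(ψ t).1 - X b| < δ ∧ |(ψ t).2 - Y b| < δ := by
        intro t
        obtain ⟨b, hb⟩ := mem_iUnion.1 (hU ⟨t, rfl⟩)
        rw [Metric.mem_ball, Prod.dist_eq, max_lt_iff, Real.dist_eq, Real.dist_eq] at hb
        exact ⟨b, hb⟩
      have hψ : ∀ a, Sol a (fun t => (ψ t).1) (fun t => (ψ t).2) := by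
        intro a t _
        have h := hsol t
        obtain ⟨b, hb1, hb2⟩ := hcl t
        obtain ⟨h1, h2, h3, h4⟩ := hB b
        rw [abs_lt] at hb1 hb2
        rw [VF_eq (by linarith) (by linarith) (by linarith) (by linarith)] at h
        exact ⟨(ContinuousLinearMap.fst ℝ ℝ ℝ).hasFDerivAt.comp_hasDerivAt t h,
          (ContinuousLinearMap.snd ℝ ℝ ℝ).hasFDerivAt.comp_hasDerivAt t h⟩
      -- a time at which `ψ` is inside the funnel
      have hin : ∃ t, ψ t ∈ KI := by
        obtain ⟨b0, hb1, hb2⟩ := hcl 0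
        obtain ⟨b, hb, hbX, hbY⟩ : ∃ b ∈ Ioc (s1 - T) (s1 - T + T), X b = X b0 ∧ Y b = Y b0 := by
          refine ⟨toIocMod hT (s1 - T) b0, toIocMod_mem_Ioc hT _ _, ?_, ?_⟩
          · exact pX.sub_zsmul_eq _
          · exact pY.sub_zsmul_eq _
        rw [← hbX] at hb1
        rw [← hbY] at hb2
        obtain ⟨hb3, hb4⟩ := hb
        have hsh := (hs b).shift b
        rw [sub_self] at hsh
        have h := cmp_sol cc cc cc_mono 0 (by simp) (fun t => (ψ t).1) (fun t => (ψ t).2)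
          (fun t => X (t + b)) (fun t => Y (t + b)) 0 (s1 - b) (by linarith)
          (fun s hs => (hψ 0 s hs.1).1) (fun s hs => (hψ 0 s hs.1).2)
          (fun s hs => (hsh s hs.1).1) (fun s hs => (hsh s hs.1).2)
        simp only [zero_add, sub_add_cancel] at h
        have g1 : Real.exp (40 * (s1 - b - 0)) ≤ E := by
          rw [hE]; apply Real.exp_le_exp.2; linarith
        have g2 : ((ψ 0).1 - X b) ^ 2 ≤ δ ^ 2 := sq_le_sq' (by linarith [(abs_lt.1 hb1).1]) (abs_lt.1 hb1).2.le
        have g3 : ((ψ 0).2 - Y b) ^ 2 ≤ δ ^ 2 := sq_le_sq' (by linarith [(abs_lt.1 hb2).1]) (abs_lt.1 hb2).2.le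
        have g4 : (((ψ 0).1 - X b) ^ 2 + ((ψ 0).2 - Y b) ^ 2 + 0 ^ 2) * Real.exp (40 * (s1 - b - 0))
            ≤ (2 * δ ^ 2) * E :=
          mul_le_mul (by linarith) g1 (Real.exp_pos _).le (by positivity)
        refine ⟨s1 - b, hball ?_⟩
        rw [Metric.mem_ball, Prod.dist_eq, max_lt_iff, Real.dist_eq, Real.dist_eq]
        constructor
        · apply abs_lt_of_sq_lt_sq _ hρ.le
          show ((ψ (s1 - b)).1 - X s1) ^ 2 < _
          nlinarith [sq_nonneg ((ψ (s1 - b)).2 - Y s1)]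
        · apply abs_lt_of_sq_lt_sq _ hρ.le
          show ((ψ (s1 - b)).2 - Y s1) ^ 2 < _
          nlinarith [sq_nonneg ((ψ (s1 - b)).1 - X s1)]
      obtain ⟨t0, k1, k2, k3, k4⟩ := hin
      obtain ⟨t2, -, j1, j2, -⟩ := KL_stage (hψ t0) ⟨k1.le, k2.le, k3.le, k4.le⟩
      have hsh := (hψ t2).shift t2
      rw [sub_self] at hsh
      have huniq := sol_unique hsh (hs 0) (by simpa [hX0] using j1) (by simpa [hY0] using j2)
      have huniq' : ∀ s, 0 ≤ s → ψ (s + t2) = (X s, Y s) := fun s hs =>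
        Prod.ext (huniq s hs).1 (huniq s hs).2
      ext z
      constructor
      · rintro ⟨t, rfl⟩
        obtain ⟨n, hn⟩ := exists_nat_gt ((t2 - t) / T')
        rw [div_lt_iff₀ hT'] at hn
        refine ⟨t + n * T' - t2, ?_⟩
        have := huniq' (t + n * T' - t2) (by linarith)
        rw [sub_add_cancel, pψ.nat_mul n t] at this
        exact this.symm
      · rintro ⟨t, rfl⟩
        obtain ⟨n, hn⟩ := exists_nat_gt ((0 - t) / T)
        rw [div_lt_iff₀ hT] at hn
        refine ⟨t + n * T + t2, ?_⟩
        rw [huniq' (t + n * T) (by linarith), pX.nat_mul n t, pY.nat_mul n t]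

lemma periodic_neg {φ : ℝ → ℝ × ℝ} (h : IsPeriodicOrbit VF φ) :
    IsPeriodicOrbit VF (fun t => -φ t) := by
  obtain ⟨h1, ⟨T, hT, hp⟩, h3⟩ := h
  refine ⟨fun t => ?_, ⟨T, hT, fun t => by simp only [hp t]⟩, ?_⟩
  · rw [VF_neg]; exact (h1 t).neg
  · rintro ⟨c, hc⟩
    exact h3 ⟨-c, fun t => by rw [← hc t, neg_neg]⟩

lemma limit_neg {φ : ℝ → ℝ × ℝ} (h : IsLimitCycle VF φ) :
    IsLimitCycle VF (fun t => -φ t) := by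
  obtain ⟨h1, U, hU, hr, hi⟩ := h
  refine ⟨periodic_neg h1, (fun z => -z) ⁻¹' U, hU.preimage continuous_neg, ?_, ?_⟩
  · rintro _ ⟨t, rfl⟩
    simpa using hr ⟨t, rfl⟩
  · intro ψ hψ hψU
    have key := hi (fun t => -ψ t) (periodic_neg hψ) (by
      rintro _ ⟨t, rfl⟩
      exact hψU ⟨t, rfl⟩)
    ext z
    have k := Set.ext_iff.1 key (-z)
    simp only [Set.mem_range] at k ⊢
    constructor
    · rintro ⟨t, rfl⟩
      obtain ⟨s, hs⟩ := k.1 ⟨t, rfl⟩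
      exact ⟨s, by rw [hs, neg_neg]⟩
    · rintro ⟨t, rfl⟩
      obtain ⟨s, hs⟩ := k.2 ⟨t, by rw [neg_neg]⟩
      exact ⟨s, by rw [← neg_neg (ψ s), hs, neg_neg]⟩


/-- There exist real parameters such that the planar system
`ẋ = s₁ + p₁₁x + p₁₂y + q₁₁·x^{1/3} + q₁₂·√(y)`,
`ẏ = s₂ + p₂₁x + p₂₂y + q₂₁·x^{1/3} + q₂₂·√(y)`
has at least two limit cycles crossing the set `Σ = {xy = 0}`. -/
theorem statement10 :
    ∃ s₁ s₂ p₁₁ p₁₂ p₂₁ p₂₂ q₁₁ q₁₂ q₂₁ q₂₂ : ℝ,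
      ∃ φ ψ : ℝ → ℝ × ℝ,
        IsLimitCycle
          (fun z : ℝ × ℝ =>
            ((s₁ + p₁₁ * z.1 + p₁₂ * z.2 + q₁₁ * cbrt z.1 + q₁₂ * oddSqrt z.2,
              s₂ + p₂₁ * z.1 + p₂₂ * z.2 + q₂₁ * cbrt z.1 + q₂₂ * oddSqrt z.2) : ℝ × ℝ))
          φ ∧
        IsLimitCycle
          (fun z : ℝ × ℝ =>
            ((s₁ + p₁₁ * z.1 + p₁₂ * z.2 + q₁₁ * cbrt z.1 + q₁₂ * oddSqrt z.2,
              s₂ + p₂₁ * z.1 + p₂₂ * z.2 + q₂₁ * cbrt z.1 + q₂₂ * oddSqrt z.2) : ℝ × ℝ))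
          ψ ∧
        Set.range φ ≠ Set.range ψ ∧
        (Set.range φ ∩ {z : ℝ × ℝ | z.1 * z.2 = 0}).Nonempty ∧
        (Set.range ψ ∩ {z : ℝ × ℝ | z.1 * z.2 = 0}).Nonempty := by
  obtain ⟨φ, hφ, h0, hpos⟩ := main_cycle_s10
  refine ⟨0, 0, 1, 8, -1, 1, -3, -8, 0, -1/2, φ, fun t => -φ t, hφ, limit_neg hφ, ?_, ?_, ?_⟩
  · intro h
    obtain ⟨t, ht⟩ : φ 0 ∈ Set.range (fun t => -φ t) := h ▸ Set.mem_range_self 0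
    have h1 := congrArg Prod.snd ht
    have h2 := hpos t
    have h3 := hpos 0
    simp only [Prod.snd_neg] at h1
    linarith
  · exact ⟨φ 0, ⟨0, rfl⟩, by simp [h0]⟩
  · exact ⟨-φ 0, ⟨0, rfl⟩, by simp [h0]⟩
end
end
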